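/- If G is a non-complete chordal graph, then the edge ideal I(Ḡ) of the complement of G has a 2-linear resolution over every field K. Combined with the converse, a graph G is chordal if and only if I(Ḡ) has a linear resolution (Fröberg's theorem). -/

import Mathlib

open MvPolynomial

noncomputable section

/-- The irrelevant (graded maximal) ideal `(x_i : i)` of a polynomial ring. -/
def irrelevantIdeal (K : Type) [Field K] (σ : Type) : Ideal (MvPolynomial σ K) :=
  Ideal.span (Set.range (X : σ → MvPolynomial σ K))

/-- `depthIdeal m M` is the depth of the module `M` with respect to the ideal `m`:
the supremum of lengths of `M`-regular sequences with entries in `m`. -/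
def depthIdeal {R : Type} [CommRing R] (m : Ideal R)
    (M : Type) [AddCommGroup M] [Module R M] : ℕ :=
  sSup {k | ∃ rs : List R, rs.length = k ∧ (∀ r ∈ rs, r ∈ m) ∧
    RingTheory.Sequence.IsRegular M rs}

/-- `I` is a squarefree monomial ideal: generated by squarefree monomials. -/
def IsSqFreeMonomialIdeal {K : Type} [Field K] {σ : Type}
    (I : Ideal (MvPolynomial σ K)) : Prop :=
  ∃ 𝒮 : Set (Finset σ),
    I = Ideal.span ((fun s : Finset σ => ∏ i ∈ s, (X i : MvPolynomial σ K)) '' 𝒮)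

/-- `I` is a squarefree monomial ideal generated in degree `d`. -/
def IsSqFreeMonomialIdealInDegree {K : Type} [Field K] {σ : Type}
    (I : Ideal (MvPolynomial σ K)) (d : ℕ) : Prop :=
  ∃ 𝒮 : Set (Finset σ), (∀ s ∈ 𝒮, s.card = d) ∧
    I = Ideal.span ((fun s : Finset σ => ∏ i ∈ s, (X i : MvPolynomial σ K)) '' 𝒮)

/-- The Alexander dual of a squarefree monomial ideal: the intersection of the prime
ideals `P_M = (x_i : x_i ∣ M)` over the (squarefree) monomials `M` in `I`. -/
def alexDual {K : Type} [Field K] {σ : Type}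
    (I : Ideal (MvPolynomial σ K)) : Ideal (MvPolynomial σ K) :=
  ⨅ (s : Finset σ) (_ : (∏ i ∈ s, (X i : MvPolynomial σ K)) ∈ I),
    Ideal.span ((fun i : σ => (X i : MvPolynomial σ K)) '' ↑s)

/-- The edge ideal of a simple graph. -/
def edgeIdeal (K : Type) [Field K] {σ : Type} (G : SimpleGraph σ) :
    Ideal (MvPolynomial σ K) :=
  Ideal.span {p | ∃ i j : σ, G.Adj i j ∧ p = X i * X j}

/-- A minimal graded free resolution of a (homogeneous) ideal `I` in a polynomial ring:
an exact sequence `⋯ → F₁ → F₀ → I → 0` of free modules `Fᵢ = ⊕ S(-degᵢ b)`, with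
degree-zero (homogeneous) differentials whose matrix entries lie in the irrelevant
maximal ideal (minimality). -/
structure MinimalGradedFreeResolution {K : Type} [Field K] {σ : Type}
    (I : Ideal (MvPolynomial σ K)) where
  ι : ℕ → Type
  finite : ∀ i, Finite (ι i)
  deg : ∀ i, ι i → ℕ
  d : ∀ i, (ι (i + 1) →₀ MvPolynomial σ K) →ₗ[MvPolynomial σ K]
      (ι i →₀ MvPolynomial σ K)
  ε : (ι 0 →₀ MvPolynomial σ K) →ₗ[MvPolynomial σ K] MvPolynomial σ K
  range_ε : LinearMap.range ε = I
  exact_ε : LinearMap.ker ε = LinearMap.range (d 0)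
  exact_d : ∀ i, LinearMap.ker (d i) = LinearMap.range (d (i + 1))
  homog_ε : ∀ b : ι 0, (ε (Finsupp.single b 1)).IsHomogeneous (deg 0 b)
  homog_d : ∀ i, ∀ b : ι (i + 1), ∀ c : ι i,
      (d i (Finsupp.single b 1)) c = 0 ∨
      (deg i c ≤ deg (i + 1) b ∧
        ((d i (Finsupp.single b 1)) c).IsHomogeneous (deg (i + 1) b - deg i c))
  minimal : ∀ i, ∀ b : ι (i + 1), ∀ c : ι i,
      constantCoeff ((d i (Finsupp.single b 1)) c) = 0

namespace MinimalGradedFreeResolution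

variable {K : Type} [Field K] {σ : Type} {I : Ideal (MvPolynomial σ K)}

/-- The graded Betti number `β_{i,j}` read off from a minimal graded free resolution. -/
def betti (R : MinimalGradedFreeResolution I) (i j : ℕ) : ℕ :=
  Nat.card {b : R.ι i // R.deg i b = j}

end MinimalGradedFreeResolution

/-- The graded Betti number `β_{i,j}(I)` (well defined since all minimal graded free
resolutions of `I` have the same Betti numbers). -/
def bettiNumber {K : Type} [Field K] {σ : Type} (I : Ideal (MvPolynomial σ K))
    (i j : ℕ) : ℕ :=
  sSup {b | ∃ R : MinimalGradedFreeResolution I, R.betti i j = b}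

/-- Castelnuovo–Mumford regularity: `reg I = sup { j - i : β_{i,j}(I) ≠ 0 }`. -/
def reg {K : Type} [Field K] {σ : Type} (I : Ideal (MvPolynomial σ K)) : ℕ :=
  sSup {r | ∃ i j : ℕ, bettiNumber I i j ≠ 0 ∧ j = i + r}

/-- The initial degree of a homogeneous ideal: the least degree of a nonzero
homogeneous element. -/
def indeg {K : Type} [Field K] {σ : Type} (I : Ideal (MvPolynomial σ K)) : ℕ :=
  sInf {d | ∃ p ∈ I, p ≠ 0 ∧ MvPolynomial.IsHomogeneous p d}

/-- `I` has a `d`-linear resolution: it admits a minimal graded free resolution all of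
whose Betti numbers are concentrated in `β_{i,i+d}`. -/
def HasLinearResolution {K : Type} [Field K] {σ : Type}
    (I : Ideal (MvPolynomial σ K)) (dd : ℕ) : Prop :=
  ∃ R : MinimalGradedFreeResolution I, ∀ i j : ℕ, R.betti i j ≠ 0 → j = i + dd

end
/-- `G` has an induced cycle of length `m`: an embedded `m`-cycle with no chords. -/
def HasInducedCycle {V : Type} (G : SimpleGraph V) (m : ℕ) : Prop :=
  ∃ f : ZMod m ↪ V, ∀ u v : ZMod m,
    G.Adj (f u) (f v) ↔ (u ≠ v ∧ (u - v = 1 ∨ v - u = 1))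

/-- A graph is chordal if it has no induced cycle of length at least 4. -/
def IsChordal {V : Type} (G : SimpleGraph V) : Prop :=
  ∀ m : ℕ, 4 ≤ m → ¬ HasInducedCycle G m


lemma frob_zmod_sub (l : ℕ) (u v : ZMod (l+2)) : u - v = 1 ↔
    (u.val = v.val + 1 ∨ (u.val = 0 ∧ v.val = l + 1)) := by
  rw [sub_eq_iff_eq_add, add_comm 1 v]
  have h1 : u = v + 1 ↔ u.val = (v+1).val := (ZMod.val_injective (l+2)).eq_iff.symm
  rw [h1, ZMod.val_add]
  have h2 : (1 : ZMod (l+2)).val = 1 := by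
    have : Fact (1 < l+2) := ⟨by omega⟩
    exact ZMod.val_one (l+2)
  rw [h2]
  have hu := ZMod.val_lt u
  have hv := ZMod.val_lt v
  rcases Nat.lt_or_ge (v.val + 1) (l+2) with h | h
  · rw [Nat.mod_eq_of_lt h]; omega
  · have : v.val + 1 = l + 2 := by omega
    rw [this, Nat.mod_self]; omega

lemma frob_cycle {V : Type} (G : SimpleGraph V) (l : ℕ) (hl : 2 ≤ l) (p : ℕ → V) (v : V)
    (hadj : ∀ i, i < l → G.Adj (p i) (p (i+1)))
    (hind : ∀ i j, i ≤ l → j ≤ l → G.Adj (p i) (p j) → i = j + 1 ∨ j = i + 1)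
    (hinj : ∀ i j, i ≤ l → j ≤ l → p i = p j → i = j)
    (hv : ∀ i, i ≤ l → v ≠ p i) (hv0 : G.Adj v (p 0)) (hvl : G.Adj v (p l))
    (hvi : ∀ i, 0 < i → i < l → ¬ G.Adj v (p i)) : HasInducedCycle G (l+2) := by
  refine ⟨⟨fun u => if u.val ≤ l then p u.val else v, ?_⟩, ?_⟩
  · intro u w h
    have hu := ZMod.val_lt u
    have hw := ZMod.val_lt w
    apply ZMod.val_injective (l+2)
    simp only at h
    split_ifs at h with h1 h2 h2
    · exact hinj _ _ h1 h2 h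
    · exact absurd h.symm (hv _ h1)
    · exact absurd h (hv _ h2)
    · omega
  · intro u w
    rw [frob_zmod_sub, frob_zmod_sub]
    change G.Adj (if u.val ≤ l then p u.val else v) (if w.val ≤ l then p w.val else v) ↔ _
    have hu := ZMod.val_lt u
    have hw := ZMod.val_lt w
    have hne : u ≠ w ↔ u.val ≠ w.val := (ZMod.val_injective (l+2)).ne_iff.symm
    rw [hne]
    clear hne
    generalize u.val = a at hu ⊢
    generalize w.val = b at hw ⊢
    split_ifs with h1 h2 h2
    · constructor
      · intro h
        have := hind _ _ h1 h2 h
        omega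
      · rintro ⟨h3, (h | h) | (h | h)⟩
        · subst h; exact (hadj b (by omega)).symm
        · omega
        · subst h; exact (hadj a (by omega))
        · omega
    · have hb : b = l + 1 := by omega
      constructor
      · intro h
        have : a = 0 ∨ a = l := by
          by_contra hc
          exact hvi a (by omega) (by omega) h.symm
        omega
      · intro h
        have : a = 0 ∨ a = l := by omega
        rcases this with rfl | rfl
        · exact hv0.symm
        · exact hvl.symm
    · have hb : a = l + 1 := by omega
      constructor
      · intro h
        have : b = 0 ∨ b = l := by
          by_contra hc
          exact hvi b (by omega) (by omega) h
        omega
      · intro h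
        have : b = 0 ∨ b = l := by omega
        rcases this with rfl | rfl
        · exact hv0
        · exact hvl
    · constructor
      · intro h; exact absurd h (G.loopless.irrefl v)
      · omega

/-- A graph on V keeping only the edges of G inside T. -/
def frobRestr {V : Type} (G : SimpleGraph V) (T : Set V) : SimpleGraph V where
  Adj a b := G.Adj a b ∧ a ∈ T ∧ b ∈ T
  symm := ⟨fun _ _ h => ⟨h.1.symm, h.2.2, h.2.1⟩⟩
  loopless := ⟨fun a h => G.loopless.irrefl a h.1⟩

lemma frob_geodesic {V : Type} (H : SimpleGraph V) (x y : V) (h : H.Reachable x y) :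
    ∃ p : ℕ → V, p 0 = x ∧ p (H.dist x y) = y ∧
      (∀ i, i < H.dist x y → H.Adj (p i) (p (i+1))) ∧
      (∀ i, i ≤ H.dist x y → H.dist x (p i) = i) ∧ (∀ i, H.Reachable x (p i)) := by
  obtain ⟨w, hw⟩ := h.exists_walk_length_eq_dist
  refine ⟨w.getVert, w.getVert_zero, by rw [← hw]; exact w.getVert_length, ?_, ?_, ?_⟩
  · intro i hi
    exact w.adj_getVert_succ (by omega)
  · intro i hi
    have h1 : H.dist x (w.getVert i) ≤ i := by
      have := SimpleGraph.dist_le (w.take i)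
      rw [SimpleGraph.Walk.take_length] at this
      omega
    have h2 : H.dist (w.getVert i) y ≤ H.dist x y - i := by
      have := SimpleGraph.dist_le (w.drop i)
      rw [SimpleGraph.Walk.drop_length] at this
      omega
    have h3 := SimpleGraph.Reachable.dist_triangle_left (G := H) (w.take i).reachable y
    omega
  · intro i
    exact (w.take i).reachable

/-- `w` is simplicial in the induced subgraph on `U`. -/
def FrobSimp {V : Type} (G : SimpleGraph V) (U : Finset V) (w : V) : Prop :=
  w ∈ U ∧ ∀ a ∈ U, ∀ b ∈ U, a ≠ b → G.Adj w a → G.Adj w b → G.Adj a b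

/-- The neighbourhood in N(v) of a component of G - N[v] is a clique. -/
lemma frob_clique {V : Type} (G : SimpleGraph V) (hG : IsChordal G) (v c x y : V) (D : Set V)
    (hD : ∀ d ∈ D, d ≠ v ∧ ¬ G.Adj v d)
    (hx : G.Adj v x) (hy : G.Adj v y) (hxy : x ≠ y)
    (cx cy : V) (hcx : (frobRestr G D).Reachable c cx) (hcy : (frobRestr G D).Reachable c cy)
    (hcxD : cx ∈ D) (hcyD : cy ∈ D)
    (hxc : G.Adj x cx) (hyc : G.Adj y cy) : G.Adj x y := by
  by_contra hna
  set H := frobRestr G (D ∪ {x, y}) with hH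
  have hle : frobRestr G D ≤ H := fun a b h => ⟨h.1, Or.inl h.2.1, Or.inl h.2.2⟩
  have hr : H.Reachable x y := by
    have h1 : H.Adj x cx := ⟨hxc, by simp, Or.inl hcxD⟩
    have h2 : H.Adj y cy := ⟨hyc, by simp, Or.inl hcyD⟩
    exact (h1.reachable.trans ((hcx.mono hle).symm.trans (hcy.mono hle))).trans h2.symm.reachable
  obtain ⟨p, p0, pl, padj, pd, pr⟩ := frob_geodesic H x y hr
  set l := H.dist x y with hl
  have hl2 : 2 ≤ l := by
    have h0 : l ≠ 0 := by
      intro h0; rw [h0, p0] at pl; exact hxy pl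
    have h1 : l ≠ 1 := by
      intro h1
      have := padj 0 (by omega)
      rw [p0] at this
      rw [h1] at pl
      rw [zero_add, pl] at this
      exact hna this.1
    omega
  have hmem : ∀ i, i ≤ l → p i ∈ D ∪ {x, y} := by
    intro i hi
    rcases Nat.lt_or_ge i l with h | h
    · exact (padj i h).2.1
    · have : i = l := by omega
      rw [this, pl]; simp
  have hmem' : ∀ i, 0 < i → i < l → p i ∈ D := by
    intro i h0 hi
    rcases hmem i hi.le with h | h
    · exact h
    · exfalso
      rcases h with h | h
      · have := pd i hi.le
        rw [h, SimpleGraph.dist_self] at this; omega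
      · have := pd i hi.le
        rw [h] at this; omega
  refine hG (l+2) (by omega) (frob_cycle G l hl2 p v (fun i hi => (padj i hi).1) ?_ ?_ ?_ ?_ ?_ ?_)
  · intro i j hi hj hadj
    have hHadj : H.Adj (p i) (p j) := ⟨hadj, hmem i hi, hmem j hj⟩
    have h1 := SimpleGraph.Reachable.dist_triangle_left (G := H) (pr i) (p j)
    have h2 := SimpleGraph.Reachable.dist_triangle_left (G := H) (pr j) (p i)
    have h3 : H.dist (p i) (p j) = 1 := SimpleGraph.dist_eq_one_iff_adj.2 hHadj
    rw [SimpleGraph.dist_comm (u := p j), h3] at h2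
    rw [h3] at h1
    rw [pd i hi, pd j hj] at h1 h2
    have : i ≠ j := by rintro rfl; exact G.loopless.irrefl _ hadj
    omega
  · intro i j hi hj h
    rw [← pd i hi, ← pd j hj, h]
  · intro i hi h
    rcases hmem i hi with h1 | h1 | h1
    · exact (hD _ h1).1 h.symm
    · rw [h1] at h; exact G.loopless.irrefl x (h ▸ hx)
    · rw [h1] at h; exact G.loopless.irrefl y (h ▸ hy)
  · rw [p0]; exact hx
  · rw [pl]; exact hy
  · intro i h0 hi
    exact (hD _ (hmem' i h0 hi)).2

lemma frob_dirac {V : Type} (G : SimpleGraph V) (hG : IsChordal G) : ∀ (k : ℕ) (U : Finset V),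
    U.card = k → (U.Nonempty → ∃ w, FrobSimp G U w) ∧
      (∀ v ∈ U, (∃ u ∈ U, u ≠ v ∧ ¬ G.Adj v u) →
        ∃ w, FrobSimp G U w ∧ w ≠ v ∧ ¬ G.Adj v w) := by
  classical
  intro k
  induction k using Nat.strong_induction_on with
  | _ k ih =>
  intro U hU
  have hb : ∀ v ∈ U, (∃ u ∈ U, u ≠ v ∧ ¬ G.Adj v u) →
        ∃ w, FrobSimp G U w ∧ w ≠ v ∧ ¬ G.Adj v w := by
    rintro v hv ⟨c, hcU, hcv, hcadj⟩
    set D : Set V := {d | d ∈ U ∧ d ≠ v ∧ ¬ G.Adj v d} with hD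
    have hcD : c ∈ D := ⟨hcU, hcv, hcadj⟩
    set H := frobRestr G D with hH
    set C : Finset V := U.filter (fun d => d ∈ D ∧ H.Reachable c d) with hC
    set S : Finset V := U.filter (fun s => G.Adj v s ∧ ∃ d ∈ C, G.Adj s d) with hS
    have hcC : c ∈ C := by
      rw [hC, Finset.mem_filter]; exact ⟨hcU, hcD, SimpleGraph.Reachable.refl _⟩
    -- neighbours of C
    have hnb : ∀ d ∈ C, ∀ e ∈ U, G.Adj d e → e ∈ C ∪ S := by
      intro d hd e he hde
      rw [Finset.mem_union]
      have hd' := hd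
      rw [hC, Finset.mem_filter] at hd
      by_cases hve : G.Adj v e
      · right
        rw [hS, Finset.mem_filter]
        exact ⟨he, hve, d, hd', hde.symm⟩
      · left
        have hev : e ≠ v := by
          rintro rfl; exact hd.2.1.2.2 hde.symm
        have heD : e ∈ D := ⟨he, hev, hve⟩
        rw [hC, Finset.mem_filter]
        exact ⟨he, heD, hd.2.2.trans (SimpleGraph.Adj.reachable ⟨hde, hd.2.1, heD⟩)⟩
    have hSc : ∀ x ∈ S, ∀ y ∈ S, x ≠ y → G.Adj x y := by
      intro x hx y hy hxy
      rw [hS, Finset.mem_filter] at hx hy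
      obtain ⟨_, hvx, cx, hcx, hxcx⟩ := hx
      obtain ⟨_, hvy, cy, hcy, hycy⟩ := hy
      rw [hC, Finset.mem_filter] at hcx hcy
      exact frob_clique G hG v c x y D (fun d hd => hd.2) hvx hvy hxy cx cy hcx.2.2 hcy.2.2
        hcx.2.1 hcy.2.1 hxcx hycy
    have hCS : C ∪ S ⊆ U := Finset.union_subset (Finset.filter_subset _ _) (Finset.filter_subset _ _)
    have hvCS : v ∉ C ∪ S := by
      rw [Finset.mem_union, hC, hS, Finset.mem_filter, Finset.mem_filter]
      rintro (h | h)
      · exact h.2.1.2.1 rfl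
      · exact G.loopless.irrefl v h.2.1
    have hlt : (C ∪ S).card < k := by
      rw [← hU]
      exact Finset.card_lt_card ⟨hCS, fun h => hvCS (h hv)⟩
    have hltC : C.card < k := lt_of_le_of_lt (Finset.card_le_card Finset.subset_union_left) hlt
    -- it suffices to find w in C simplicial in C ∪ S
    suffices h : ∃ w ∈ C, FrobSimp G (C ∪ S) w by
      obtain ⟨w, hwC, hw⟩ := h
      have hwD := (Finset.mem_filter.1 hwC).2.1
      refine ⟨w, ⟨hCS hw.1, ?_⟩, hwD.2.1, hwD.2.2⟩
      intro a ha b hb hab hwa hwb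
      exact hw.2 a (hnb w hwC a ha hwa) b (hnb w hwC b hb hwb) hab hwa hwb
    by_cases hs : ∃ s ∈ S, ∃ u ∈ C ∪ S, u ≠ s ∧ ¬ G.Adj s u
    · obtain ⟨s, hsS, hu⟩ := hs
      obtain ⟨w, hw, hws, hwa⟩ := (ih _ hlt (C ∪ S) rfl).2 s (Finset.mem_union_right _ hsS) hu
      refine ⟨w, ?_, hw⟩
      rcases Finset.mem_union.1 hw.1 with h | h
      · exact h
      · exact absurd (hSc s hsS w h hws.symm) hwa
    · push Not at hs
      obtain ⟨w, hw⟩ := (ih _ hltC C rfl).1 ⟨c, hcC⟩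
      refine ⟨w, hw.1, Finset.mem_union_left _ hw.1, ?_⟩
      intro a ha b hb hab hwa hwb
      rcases Finset.mem_union.1 ha with ha' | ha'
      · rcases Finset.mem_union.1 hb with hb' | hb'
        · exact hw.2 a ha' b hb' hab hwa hwb
        · exact (hs b hb' a ha hab).symm
      · exact hs a ha' b hb hab.symm
  refine ⟨?_, hb⟩
  rintro ⟨v, hv⟩
  by_cases hu : ∃ u ∈ U, u ≠ v ∧ ¬ G.Adj v u
  · obtain ⟨w, hw, _⟩ := hb v hv hu
    exact ⟨w, hw⟩
  · push Not at hu
    by_cases hne : (U.erase v).Nonempty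
    · obtain ⟨w, hw⟩ := (ih _ (by rw [← hU]; exact Finset.card_erase_lt_of_mem hv) (U.erase v) rfl).1 hne
      refine ⟨w, Finset.mem_of_mem_erase hw.1, ?_⟩
      intro a ha b hb hab hwa hwb
      by_cases hav : a = v
      · subst hav; exact hu b hb hab.symm
      by_cases hbv : b = v
      · subst hbv; exact (hu a ha hab).symm
      exact hw.2 a (Finset.mem_erase.2 ⟨hav, ha⟩) b (Finset.mem_erase.2 ⟨hbv, hb⟩) hab hwa hwb
    · refine ⟨v, hv, ?_⟩
      intro a ha b hb hab hwa hwb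
      exact absurd ⟨a, Finset.mem_erase.2 ⟨hwa.ne', ha⟩⟩ hne


section FrobAlg

variable {K : Type} [Field K] {σ : Type}

/-- All coordinates are linear forms. -/
def FrobLin1 {κ : Type} (z : κ →₀ MvPolynomial σ K) : Prop := ∀ a, (z a).IsHomogeneous 1

/-- Coordinatewise homogeneous component. -/
noncomputable def frobComp {κ : Type} (j : ℕ) (z : κ →₀ MvPolynomial σ K) :
    κ →₀ MvPolynomial σ K :=
  z.mapRange (homogeneousComponent j) (map_zero _)

/-- The relation module of the family `b` is homogeneous. -/
def FrobHomKer (K : Type) [Field K] (σ : Type) {M : Type} [AddCommGroup M] [Module (MvPolynomial σ K) M] {κ : Type} (b : κ → M) :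
    Prop :=
  ∀ z, Finsupp.linearCombination (MvPolynomial σ K) b z = 0 → ∀ j,
    Finsupp.linearCombination (MvPolynomial σ K) b (frobComp j z) = 0

lemma frob_hc_mul (p q : MvPolynomial σ K) (j e : ℕ) (hq : q.IsHomogeneous e) :
    homogeneousComponent (j + e) (p * q) = homogeneousComponent j p * q := by
  induction p using MvPolynomial.induction_on' with
  | monomial a b =>
    have hm : (monomial a b : MvPolynomial σ K).IsHomogeneous a.degree :=
      isHomogeneous_monomial b rfl
    rw [homogeneousComponent_of_mem (hm.mul hq), homogeneousComponent_of_mem hm]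
    by_cases h : j = a.degree <;> simp [h]
  | add p p' hp hp' => rw [add_mul, map_add, map_add, add_mul, hp, hp']

lemma frob_lc_comp {κ : Type} (b : κ → MvPolynomial σ K) (e : ℕ)
    (hb : ∀ a, (b a).IsHomogeneous e) (j : ℕ) (z : κ →₀ MvPolynomial σ K) :
    Finsupp.linearCombination (MvPolynomial σ K) b (frobComp j z) =
      homogeneousComponent (j + e) (Finsupp.linearCombination (MvPolynomial σ K) b z) := by
  rw [Finsupp.linearCombination_apply, Finsupp.linearCombination_apply, frobComp,
    Finsupp.sum_mapRange_index (by simp), Finsupp.sum, Finsupp.sum, map_sum]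
  refine Finset.sum_congr rfl fun a _ => ?_
  rw [smul_eq_mul, smul_eq_mul, frob_hc_mul _ _ _ _ (hb a)]

lemma frob_lc_apply {κ κ' : Type} (b : κ → (κ' →₀ MvPolynomial σ K)) (c : κ')
    (z : κ →₀ MvPolynomial σ K) :
    Finsupp.linearCombination (MvPolynomial σ K) b z c =
      Finsupp.linearCombination (MvPolynomial σ K) (fun a => b a c) z := by
  rw [Finsupp.linearCombination_apply, Finsupp.linearCombination_apply, Finsupp.sum_apply]
  rfl

lemma frob_homKer_sub {κ κ' : Type} (N : Submodule (MvPolynomial σ K) (κ' →₀ MvPolynomial σ K))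
    (b : κ → N) (hb : ∀ a, FrobLin1 (b a : κ' →₀ MvPolynomial σ K)) : FrobHomKer K σ b := by
  intro z hz j
  have key : ∀ z, ((Finsupp.linearCombination (MvPolynomial σ K) b z : N) :
      κ' →₀ MvPolynomial σ K) =
      Finsupp.linearCombination (MvPolynomial σ K) (fun a => (b a : κ' →₀ MvPolynomial σ K)) z := by
    intro z
    exact Finsupp.apply_linearCombination (MvPolynomial σ K) N.subtype b z
  apply Subtype.ext
  ext1 c
  rw [key, frob_lc_apply, frob_lc_comp _ 1 (fun a => hb a c), ← frob_lc_apply, ← key, hz]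
  simp

/-- projections and injections for sums -/
noncomputable abbrev frobInL (κ κ' : Type) :
    (κ →₀ MvPolynomial σ K) →ₗ[MvPolynomial σ K] (κ ⊕ κ' →₀ MvPolynomial σ K) :=
  Finsupp.lmapDomain _ _ Sum.inl
noncomputable abbrev frobInR (κ κ' : Type) :
    (κ' →₀ MvPolynomial σ K) →ₗ[MvPolynomial σ K] (κ ⊕ κ' →₀ MvPolynomial σ K) :=
  Finsupp.lmapDomain _ _ Sum.inr
noncomputable abbrev frobPrL (κ κ' : Type) :
    (κ ⊕ κ' →₀ MvPolynomial σ K) →ₗ[MvPolynomial σ K] (κ →₀ MvPolynomial σ K) :=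
  Finsupp.lcomapDomain Sum.inl Sum.inl_injective
noncomputable abbrev frobPrR (κ κ' : Type) :
    (κ ⊕ κ' →₀ MvPolynomial σ K) →ₗ[MvPolynomial σ K] (κ' →₀ MvPolynomial σ K) :=
  Finsupp.lcomapDomain Sum.inr Sum.inr_injective

lemma frobPrL_apply {κ κ' : Type} (z : κ ⊕ κ' →₀ MvPolynomial σ K) (a : κ) :
    frobPrL κ κ' z a = z (Sum.inl a) := rfl
lemma frobPrR_apply {κ κ' : Type} (z : κ ⊕ κ' →₀ MvPolynomial σ K) (a : κ') :
    frobPrR κ κ' z a = z (Sum.inr a) := rfl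

lemma frobInL_inl {κ κ' : Type} (z : κ →₀ MvPolynomial σ K) (a : κ) :
    frobInL κ κ' z (Sum.inl a) = z a :=
  Finsupp.mapDomain_apply Sum.inl_injective z a
lemma frobInR_inr {κ κ' : Type} (z : κ' →₀ MvPolynomial σ K) (a : κ') :
    frobInR κ κ' z (Sum.inr a) = z a :=
  Finsupp.mapDomain_apply Sum.inr_injective z a
lemma frobInL_inr {κ κ' : Type} (z : κ →₀ MvPolynomial σ K) (a : κ') :
    frobInL κ κ' z (Sum.inr a) = 0 :=
  Finsupp.mapDomain_of_notMem_range z _ (by simp)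
lemma frobInR_inl {κ κ' : Type} (z : κ' →₀ MvPolynomial σ K) (a : κ) :
    frobInR κ κ' z (Sum.inl a) = 0 :=
  Finsupp.mapDomain_of_notMem_range z _ (by simp)

lemma frobPrR_inL {κ κ' : Type} (z : κ →₀ MvPolynomial σ K) :
    frobPrR κ κ' (frobInL κ κ' z) = 0 := by
  ext1 a; rw [frobPrR_apply, frobInL_inr]; rfl
lemma frobPrR_inR {κ κ' : Type} (z : κ' →₀ MvPolynomial σ K) :
    frobPrR κ κ' (frobInR κ κ' z) = z := by
  ext1 a; rw [frobPrR_apply, frobInR_inr]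
lemma frobPrL_inL {κ κ' : Type} (z : κ →₀ MvPolynomial σ K) :
    frobPrL κ κ' (frobInL κ κ' z) = z := by
  ext1 a; rw [frobPrL_apply, frobInL_inl]
lemma frobPrL_inR {κ κ' : Type} (z : κ' →₀ MvPolynomial σ K) :
    frobPrL κ κ' (frobInR κ κ' z) = 0 := by
  ext1 a; rw [frobPrL_apply, frobInR_inl]; rfl

lemma frob_decomp {κ κ' : Type} (z : κ ⊕ κ' →₀ MvPolynomial σ K) :
    z = frobInL κ κ' (frobPrL κ κ' z) + frobInR κ κ' (frobPrR κ κ' z) := by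
  ext1 a
  rw [Finsupp.add_apply]
  rcases a with a | a
  · rw [frobInL_inl, frobInR_inl, add_zero]; rfl
  · rw [frobInL_inr, frobInR_inr, zero_add]; rfl

lemma frob_lc_sum {κ κ' M : Type} [AddCommGroup M] [Module (MvPolynomial σ K) M]
    (b : κ ⊕ κ' → M) (z : κ ⊕ κ' →₀ MvPolynomial σ K) :
    Finsupp.linearCombination (MvPolynomial σ K) b z =
      Finsupp.linearCombination (MvPolynomial σ K) (fun a => b (Sum.inl a)) (frobPrL κ κ' z) +
      Finsupp.linearCombination (MvPolynomial σ K) (fun a => b (Sum.inr a)) (frobPrR κ κ' z) := by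
  conv_lhs => rw [frob_decomp z]
  rw [map_add, Finsupp.lmapDomain_apply, Finsupp.lmapDomain_apply,
    Finsupp.linearCombination_mapDomain, Finsupp.linearCombination_mapDomain]
  rfl

variable (K σ)

/-- An inductive class of modules with generators, closed under passing to linear relations. -/
inductive FrobQ : (M : Type) → [AddCommGroup M] → [Module (MvPolynomial σ K) M] → (κ : Type) →
    (κ → M) → Prop
  | free (M : Type) [AddCommGroup M] [Module (MvPolynomial σ K) M] (κ : Type) (b : κ → M)
      (h : Function.Bijective (Finsupp.linearCombination (MvPolynomial σ K) b)) : FrobQ M κ b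
  | ext (M' M M'' : Type) [AddCommGroup M'] [Module (MvPolynomial σ K) M']
      [AddCommGroup M] [Module (MvPolynomial σ K) M]
      [AddCommGroup M''] [Module (MvPolynomial σ K) M'']
      (κ' κ'' : Type) (b' : κ' → M') (b'' : κ'' → M'') (b : κ' ⊕ κ'' → M)
      (f : M' →ₗ[MvPolynomial σ K] M) (g : M →ₗ[MvPolynomial σ K] M'')
      (hf : Function.Injective f) (hg : Function.Surjective g)
      (hfg : ∀ m, g m = 0 ↔ ∃ m', f m' = m)
      (hb' : ∀ a, b (Sum.inl a) = f (b' a)) (hb'' : ∀ a, g (b (Sum.inr a)) = b'' a)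
      (hker : FrobHomKer K σ b) (h' : FrobQ M' κ' b') (h'' : FrobQ M'' κ'' b'') :
      FrobQ M (κ' ⊕ κ'') b
  | split (A B I : Ideal (MvPolynomial σ K)) (x : MvPolynomial σ K) (hx1 : x.IsHomogeneous 1)
      (e : ℕ) (κA κB : Type) (bA : κA → A) (bB : κB → B) (b : κA ⊕ κB → I)
      (hAB : A ≤ B) (hx : ∀ f, x * f ∈ A → f ∈ A) (hI : I = A ⊔ Ideal.span {x} * B)
      (hbA : ∀ a, (b (Sum.inl a) : MvPolynomial σ K) = bA a)
      (hbB : ∀ a, (b (Sum.inr a) : MvPolynomial σ K) = x * bB a)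
      (hA : ∀ a, (bA a : MvPolynomial σ K).IsHomogeneous (e+1))
      (hB : ∀ a, (bB a : MvPolynomial σ K).IsHomogeneous e)
      (h' : FrobQ A κA bA) (h'' : FrobQ B κB bB) : FrobQ I (κA ⊕ κB) b

variable {K σ}

/-- The conclusion of the step lemma. -/
def FrobStep (K : Type) [Field K] (σ : Type) (M : Type) [AddCommGroup M] [Module (MvPolynomial σ K) M] (κ : Type)
    (b : κ → M) : Prop :=
  Function.Surjective (Finsupp.linearCombination (MvPolynomial σ K) b) ∧
    ∃ (κ' : Type) (b' : κ' → LinearMap.ker (Finsupp.linearCombination (MvPolynomial σ K) b)),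
      (Finite κ → Finite κ') ∧ (∀ c, FrobLin1 (b' c : κ →₀ MvPolynomial σ K)) ∧
      FrobQ K σ (LinearMap.ker (Finsupp.linearCombination (MvPolynomial σ K) b)) κ' b'

lemma frobLin1_inL {κ κ' : Type} (z : κ →₀ MvPolynomial σ K) (hz : FrobLin1 z) :
    FrobLin1 (frobInL κ κ' z) := by
  rintro (a | a)
  · rw [frobInL_inl]; exact hz a
  · rw [frobInL_inr]; exact isHomogeneous_zero _ _ _
lemma frobLin1_inR {κ κ' : Type} (z : κ' →₀ MvPolynomial σ K) (hz : FrobLin1 z) :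
    FrobLin1 (frobInR κ κ' z) := by
  rintro (a | a)
  · rw [frobInR_inl]; exact isHomogeneous_zero _ _ _
  · rw [frobInR_inr]; exact hz a
lemma frobLin1_comp {κ : Type} (z : κ →₀ MvPolynomial σ K) : FrobLin1 (frobComp 1 z) := by
  intro a
  rw [frobComp, Finsupp.mapRange_apply]
  exact homogeneousComponent_isHomogeneous _ _

lemma frob_step_free (M : Type) [AddCommGroup M] [Module (MvPolynomial σ K) M] (κ : Type)
    (b : κ → M) (h : Function.Bijective (Finsupp.linearCombination (MvPolynomial σ K) b)) :
    FrobStep K σ M κ b := by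
  refine ⟨h.2, Empty, fun e => e.elim, fun _ => inferInstance, fun c => c.elim, FrobQ.free _ _ _ ?_⟩
  have : Subsingleton (LinearMap.ker (Finsupp.linearCombination (MvPolynomial σ K) b)) := by
    rw [LinearMap.ker_eq_bot.2 h.1]; infer_instance
  exact ⟨Function.injective_of_subsingleton _, fun m => ⟨0, Subsingleton.elim _ _⟩⟩

lemma frob_step_ext (M' M M'' : Type) [AddCommGroup M'] [Module (MvPolynomial σ K) M']
      [AddCommGroup M] [Module (MvPolynomial σ K) M]
      [AddCommGroup M''] [Module (MvPolynomial σ K) M'']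
      (κ' κ'' : Type) (b' : κ' → M') (b'' : κ'' → M'') (b : κ' ⊕ κ'' → M)
      (f : M' →ₗ[MvPolynomial σ K] M) (g : M →ₗ[MvPolynomial σ K] M'')
      (hf : Function.Injective f) (hg : Function.Surjective g)
      (hfg : ∀ m, g m = 0 ↔ ∃ m', f m' = m)
      (hb' : ∀ a, b (Sum.inl a) = f (b' a)) (hb'' : ∀ a, g (b (Sum.inr a)) = b'' a)
      (hker : FrobHomKer K σ b) (h' : FrobStep K σ M' κ' b') (h'' : FrobStep K σ M'' κ'' b'') :
      FrobStep K σ M (κ' ⊕ κ'') b := by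
  obtain ⟨s', κ1', b1', fin1', lin1', Q1'⟩ := h'
  obtain ⟨s'', κ1'', b1'', fin1'', lin1'', Q1''⟩ := h''
  have hL : ∀ z, Finsupp.linearCombination (MvPolynomial σ K) (fun a => b (Sum.inl a)) z =
      f (Finsupp.linearCombination (MvPolynomial σ K) b' z) := by
    intro z
    rw [Finsupp.apply_linearCombination]
    congr 2
    funext a; exact hb' a
  have hR : ∀ z, g (Finsupp.linearCombination (MvPolynomial σ K) (fun a => b (Sum.inr a)) z) =
      Finsupp.linearCombination (MvPolynomial σ K) b'' z := by
    intro z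
    rw [Finsupp.apply_linearCombination]
    congr 2
    funext a; exact hb'' a
  have hgf : ∀ m', g (f m') = 0 := fun m' => (hfg _).2 ⟨m', rfl⟩
  have hsum : ∀ z, Finsupp.linearCombination (MvPolynomial σ K) b z = f (Finsupp.linearCombination (MvPolynomial σ K) b'
      (frobPrL κ' κ'' z)) + Finsupp.linearCombination (MvPolynomial σ K) (fun a => b (Sum.inr a))
        (frobPrR κ' κ'' z) := by
    intro z; rw [frob_lc_sum, hL]
  have hgs : ∀ z, g (Finsupp.linearCombination (MvPolynomial σ K) b z) =
      Finsupp.linearCombination (MvPolynomial σ K) b'' (frobPrR κ' κ'' z) := by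
    intro z; rw [hsum, map_add, hgf, zero_add, hR]
  -- given p, and g m = lc p, find q
  have hlift : ∀ m p, g m = Finsupp.linearCombination (MvPolynomial σ K) b'' p →
      ∃ q, Finsupp.linearCombination (MvPolynomial σ K) b (frobInL κ' κ'' q + frobInR κ' κ'' p) = m := by
    intro m p hp
    rw [← hR, ← sub_eq_zero, ← map_sub, hfg] at hp
    obtain ⟨m', hm'⟩ := hp
    obtain ⟨q, hq⟩ := s' m'
    refine ⟨q, ?_⟩
    rw [hsum, map_add (frobPrL κ' κ''), map_add (frobPrR κ' κ''), frobPrL_inL, frobPrL_inR,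
      frobPrR_inL, frobPrR_inR, zero_add, add_zero, hq, hm']
    abel
  refine ⟨?_, ?_⟩
  · intro m
    obtain ⟨p, hp⟩ := s'' (g m)
    obtain ⟨q, hq⟩ := hlift m p hp.symm
    exact ⟨_, hq⟩
  have hlin : ∀ c, ∃ z : LinearMap.ker (Finsupp.linearCombination (MvPolynomial σ K) b),
      FrobLin1 (z : κ' ⊕ κ'' →₀ MvPolynomial σ K) ∧ frobPrR κ' κ'' (z : κ' ⊕ κ'' →₀ MvPolynomial σ K) = (b1'' c : κ'' →₀ MvPolynomial σ K) := by
    intro c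
    obtain ⟨q, hq⟩ := hlift 0 (b1'' c) (by rw [map_zero]; exact (LinearMap.mem_ker.1 (b1'' c).2).symm)
    have hq1 := hker _ hq 1
    refine ⟨⟨_, LinearMap.mem_ker.2 hq1⟩, frobLin1_comp _, ?_⟩
    dsimp only
    ext1 a
    rw [frobPrR_apply, frobComp, Finsupp.mapRange_apply, Finsupp.add_apply, frobInL_inr,
      frobInR_inr, zero_add]
    exact homogeneousComponent_eq_self (lin1'' c a)
  choose lift hlift1 hlift2 using hlin
  let f1 : LinearMap.ker (Finsupp.linearCombination (MvPolynomial σ K) b') →ₗ[MvPolynomial σ K]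
      LinearMap.ker (Finsupp.linearCombination (MvPolynomial σ K) b) :=
    LinearMap.restrict (frobInL κ' κ'') (by
      intro z hz
      rw [LinearMap.mem_ker] at hz ⊢
      rw [hsum, frobPrL_inL, frobPrR_inL, hz, map_zero, map_zero, add_zero])
  let g1 : LinearMap.ker (Finsupp.linearCombination (MvPolynomial σ K) b) →ₗ[MvPolynomial σ K]
      LinearMap.ker (Finsupp.linearCombination (MvPolynomial σ K) b'') :=
    LinearMap.restrict (frobPrR κ' κ'') (by
      intro z hz
      rw [LinearMap.mem_ker] at hz ⊢
      rw [← hgs, hz, map_zero])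
  have hcoe : ∀ z, (f1 z : κ' ⊕ κ'' →₀ MvPolynomial σ K) = frobInL κ' κ'' z := fun z => rfl
  have hcoeg : ∀ z, (g1 z : κ'' →₀ MvPolynomial σ K) = frobPrR κ' κ'' z := fun z => rfl
  have hlinb : ∀ c, FrobLin1 ((Sum.elim (fun a => f1 (b1' a)) lift c :
      LinearMap.ker (Finsupp.linearCombination (MvPolynomial σ K) b)) : κ' ⊕ κ'' →₀ MvPolynomial σ K) := by
    rintro (c | c)
    · exact frobLin1_inL _ (lin1' c)
    · exact hlift1 c
  refine ⟨κ1' ⊕ κ1'', Sum.elim (fun a => f1 (b1' a)) lift, ?_, hlinb, ?_⟩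
  · intro hfin
    have := fin1' (Finite.of_injective (Sum.inl : κ' → κ' ⊕ κ'') Sum.inl_injective)
    have := fin1'' (Finite.of_injective (Sum.inr : κ'' → κ' ⊕ κ'') Sum.inr_injective)
    infer_instance
  · refine FrobQ.ext _ _ _ κ1' κ1'' b1' b1'' _ f1 g1 ?_ ?_ ?_ (fun a => rfl) ?_
      (frob_homKer_sub _ _ hlinb) Q1' Q1''
    · intro z w h
      apply Subtype.ext
      have := congrArg (fun t => frobPrL κ' κ'' (Subtype.val t)) h
      simpa only [hcoe, frobPrL_inL] using this
    · intro p
      obtain ⟨q, hq⟩ := hlift 0 p (by rw [map_zero]; exact (LinearMap.mem_ker.1 p.2).symm)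
      refine ⟨⟨_, LinearMap.mem_ker.2 hq⟩, Subtype.ext ?_⟩
      rw [hcoeg, map_add, frobPrR_inL, frobPrR_inR, zero_add]
    · intro z
      constructor
      · intro h
        have h0 : frobPrR κ' κ'' (z : κ' ⊕ κ'' →₀ MvPolynomial σ K) = 0 := congrArg Subtype.val h
        have hz : Finsupp.linearCombination (MvPolynomial σ K) b z = 0 := LinearMap.mem_ker.1 z.2
        rw [hsum, h0, map_zero, add_zero] at hz
        refine ⟨⟨frobPrL κ' κ'' (z : κ' ⊕ κ'' →₀ MvPolynomial σ K), LinearMap.mem_ker.2 (hf (hz.trans (map_zero f).symm))⟩, Subtype.ext ?_⟩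
        rw [hcoe]
        conv_rhs => rw [frob_decomp (z : κ' ⊕ κ'' →₀ MvPolynomial σ K), h0, map_zero, add_zero]
      · rintro ⟨w, rfl⟩
        apply Subtype.ext
        rw [hcoeg, hcoe, frobPrR_inL]; rfl
    · intro a
      exact Subtype.ext (hlift2 a)

end FrobAlg


section FrobAlg2

variable {K : Type} [Field K] {σ : Type}

lemma frob_coe_lc (I : Ideal (MvPolynomial σ K)) {κ : Type} (b : κ → I)
    (z : κ →₀ MvPolynomial σ K) :
    ((Finsupp.linearCombination (MvPolynomial σ K) b z : I) : MvPolynomial σ K) =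
      Finsupp.linearCombination (MvPolynomial σ K) (fun a => (b a : MvPolynomial σ K)) z :=
  Finsupp.apply_linearCombination (MvPolynomial σ K) (Submodule.subtype I) b z

lemma frobLin1_single {κ : Type} (c : κ) (x : MvPolynomial σ K) (hx : x.IsHomogeneous 1) :
    FrobLin1 (Finsupp.single c x) := by
  classical
  intro a
  rw [Finsupp.single_apply]
  split_ifs
  · exact hx
  · exact isHomogeneous_zero _ _ _

lemma frobLin1_add {κ : Type} (z w : κ →₀ MvPolynomial σ K) (hz : FrobLin1 z) (hw : FrobLin1 w) :
    FrobLin1 (z + w) := fun a => (hz a).add (hw a)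

set_option maxHeartbeats 2000000 in
lemma frob_step_split (A B I : Ideal (MvPolynomial σ K)) (x : MvPolynomial σ K)
      (hx1 : x.IsHomogeneous 1)
      (e : ℕ) (κA κB : Type) (bA : κA → A) (bB : κB → B) (b : κA ⊕ κB → I)
      (hAB : A ≤ B) (hx : ∀ f, x * f ∈ A → f ∈ A) (hI : I = A ⊔ Ideal.span {x} * B)
      (hbA : ∀ a, (b (Sum.inl a) : MvPolynomial σ K) = bA a)
      (hbB : ∀ a, (b (Sum.inr a) : MvPolynomial σ K) = x * bB a)
      (hA : ∀ a, (bA a : MvPolynomial σ K).IsHomogeneous (e+1))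
      (hB : ∀ a, (bB a : MvPolynomial σ K).IsHomogeneous e)
      (hQA : FrobQ K σ A κA bA)
      (h' : FrobStep K σ A κA bA) (h'' : FrobStep K σ B κB bB) :
      FrobStep K σ I (κA ⊕ κB) b := by
  obtain ⟨sA, κAone, b1A, fin1A, lin1A, Q1A⟩ := h'
  obtain ⟨sB, κBone, b1B, fin1B, lin1B, Q1B⟩ := h''
  have hsum : ∀ z, ((Finsupp.linearCombination (MvPolynomial σ K) b z : I) : MvPolynomial σ K) =
      (Finsupp.linearCombination (MvPolynomial σ K) bA (frobPrL κA κB z) : A) +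
      x * (Finsupp.linearCombination (MvPolynomial σ K) bB (frobPrR κA κB z) : B) := by
    intro z
    rw [frob_coe_lc, frob_lc_sum, frob_coe_lc, frob_coe_lc]
    congr 1
    · congr 2; funext a; exact hbA a
    · rw [← smul_eq_mul, ← LinearMap.smul_apply]
      congr 1
      ext a
      simp [hbB]
  have hsurj : Function.Surjective (Finsupp.linearCombination (MvPolynomial σ K) b) := by
    rintro ⟨m, hm⟩
    have hm' := hm
    rw [hI] at hm'
    obtain ⟨f, hf, g, hg, rfl⟩ := Submodule.mem_sup.1 hm'
    obtain ⟨g', hg', rfl⟩ := Ideal.mem_span_singleton_mul.1 hg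
    obtain ⟨p, hp⟩ := sA ⟨f, hf⟩
    obtain ⟨q, hq⟩ := sB ⟨g', hg'⟩
    refine ⟨frobInL κA κB p + frobInR κA κB q, Subtype.ext ?_⟩
    rw [hsum, map_add (frobPrL κA κB), map_add (frobPrR κA κB), frobPrL_inL, frobPrL_inR,
      frobPrR_inL, frobPrR_inR, zero_add, add_zero, hp, hq]
  refine ⟨hsurj, ?_⟩
  -- linear lifts of the generators of A to B
  have hlin : ∀ c, ∃ q : κB →₀ MvPolynomial σ K, FrobLin1 q ∧
      ((Finsupp.linearCombination (MvPolynomial σ K) bB q : B) : MvPolynomial σ K) = bA c := by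
    intro c
    obtain ⟨q, hq⟩ := sB ⟨bA c, hAB (bA c).2⟩
    refine ⟨frobComp 1 q, frobLin1_comp _, ?_⟩
    rw [frob_coe_lc, frob_lc_comp _ e hB, ← frob_coe_lc, hq]
    exact homogeneousComponent_eq_self (by rw [add_comm]; exact hA c)
  choose q hq1 hq2 using hlin
  let ψ : (κB →₀ MvPolynomial σ K) →ₗ[MvPolynomial σ K] MvPolynomial σ K :=
    (Submodule.subtype B).comp (Finsupp.linearCombination (MvPolynomial σ K) bB)
  have hψ : ∀ z, ψ z = (Finsupp.linearCombination (MvPolynomial σ K) bB z : B) := fun z => rfl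
  let Y : Submodule (MvPolynomial σ K) (κB →₀ MvPolynomial σ K) := Submodule.comap ψ A
  have hY : ∀ z, z ∈ Y ↔ ψ z ∈ A := fun z => Iff.rfl
  have hkerY : LinearMap.ker (Finsupp.linearCombination (MvPolynomial σ K) bB) ≤ Y := by
    intro z hz
    rw [hY, hψ, LinearMap.mem_ker.1 hz]
    exact A.zero_mem
  let bY : κBone ⊕ κA → Y := Sum.elim (fun a => ⟨b1B a, hkerY (b1B a).2⟩)
    (fun c => ⟨q c, by rw [hY, hψ, hq2]; exact (bA c).2⟩)
  have hlinY : ∀ c, FrobLin1 (bY c : κB →₀ MvPolynomial σ K) := by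
    rintro (c | c)
    · exact lin1B c
    · exact hq1 c
  have QY : FrobQ K σ Y (κBone ⊕ κA) bY := by
    let gY : Y →ₗ[MvPolynomial σ K] A :=
      LinearMap.codRestrict A (ψ.comp Y.subtype) (fun z => (hY z).1 z.2)
    have hgY : ∀ z, (gY z : MvPolynomial σ K) = ψ z := fun z => rfl
    refine FrobQ.ext _ _ _ κBone κA b1B bA bY (Submodule.inclusion hkerY) gY
      (Submodule.inclusion_injective hkerY) ?_ ?_ (fun a => rfl) ?_ (frob_homKer_sub _ _ hlinY)
      Q1B hQA
    · rintro ⟨f, hf⟩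
      obtain ⟨p, hp⟩ := sB ⟨f, hAB hf⟩
      have hp' : ψ p = f := by rw [hψ, hp]
      refine ⟨⟨p, by rw [hY, hp']; exact hf⟩, Subtype.ext ?_⟩
      rw [hgY]; exact hp'
    · intro z
      constructor
      · intro h
        have h0 : ψ z = 0 := by rw [← hgY, h]; rfl
        exact ⟨⟨z, LinearMap.mem_ker.2 (Subtype.ext h0)⟩, rfl⟩
      · rintro ⟨w, rfl⟩
        apply Subtype.ext
        rw [hgY]
        change ψ w = 0
        rw [hψ, LinearMap.mem_ker.1 w.2]; rfl
    · intro c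
      apply Subtype.ext
      rw [hgY]
      exact hq2 c
  -- now the relation module of I
  let f1 : LinearMap.ker (Finsupp.linearCombination (MvPolynomial σ K) bA) →ₗ[MvPolynomial σ K]
      LinearMap.ker (Finsupp.linearCombination (MvPolynomial σ K) b) :=
    LinearMap.restrict (frobInL κA κB) (by
      intro z hz
      rw [LinearMap.mem_ker] at hz ⊢
      apply Subtype.ext
      rw [hsum, frobPrL_inL, frobPrR_inL, hz, map_zero]
      simp)
  have hprY : ∀ z ∈ LinearMap.ker (Finsupp.linearCombination (MvPolynomial σ K) b),
      frobPrR κA κB z ∈ Y := by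
    intro z hz
    have h0 := hsum z
    rw [LinearMap.mem_ker.1 hz] at h0
    rw [hY, hψ]
    apply hx
    have h1 : x * ((Finsupp.linearCombination (MvPolynomial σ K) bB (frobPrR κA κB z) : B) :
        MvPolynomial σ K) = -((Finsupp.linearCombination (MvPolynomial σ K) bA
          (frobPrL κA κB z) : A) : MvPolynomial σ K) :=
      eq_neg_of_add_eq_zero_right h0.symm
    rw [h1]
    exact A.neg_mem (Subtype.mem _)
  let g1 : LinearMap.ker (Finsupp.linearCombination (MvPolynomial σ K) b) →ₗ[MvPolynomial σ K] Y :=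
    LinearMap.restrict (frobPrR κA κB) hprY
  have hcoe : ∀ z, (f1 z : κA ⊕ κB →₀ MvPolynomial σ K) = frobInL κA κB z := fun z => rfl
  have hcoeg : ∀ z, (g1 z : κB →₀ MvPolynomial σ K) = frobPrR κA κB z := fun z => rfl
  have hl : ∀ p r, ((Finsupp.linearCombination (MvPolynomial σ K) bA p : A) : MvPolynomial σ K) +
      x * (Finsupp.linearCombination (MvPolynomial σ K) bB r : B) = 0 →
      frobInL κA κB p + frobInR κA κB r ∈
        LinearMap.ker (Finsupp.linearCombination (MvPolynomial σ K) b) := by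
    intro p r h
    rw [LinearMap.mem_ker]
    apply Subtype.ext
    rw [hsum, map_add (frobPrL κA κB), map_add (frobPrR κA κB), frobPrL_inL, frobPrL_inR,
      frobPrR_inL, frobPrR_inR, zero_add, add_zero, h]; rfl
  have hpr : ∀ (p : κA →₀ MvPolynomial σ K) (r : κB →₀ MvPolynomial σ K),
      frobPrR κA κB (frobInL κA κB p + frobInR κA κB r) = r := by
    intro p r
    rw [map_add (frobPrR κA κB), frobPrR_inL, frobPrR_inR, zero_add]
  have hlB : ∀ a, frobInL κA κB 0 + frobInR κA κB (b1B a : κB →₀ MvPolynomial σ K) ∈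
        LinearMap.ker (Finsupp.linearCombination (MvPolynomial σ K) b) := by
    intro a
    apply hl
    rw [LinearMap.mem_ker.1 (b1B a).2, map_zero]
    simp
  have hlA : ∀ c, frobInL κA κB (Finsupp.single c (-x)) + frobInR κA κB (q c) ∈
        LinearMap.ker (Finsupp.linearCombination (MvPolynomial σ K) b) := by
    intro c
    apply hl
    rw [hq2, Finsupp.linearCombination_single]
    simp
  let b1 : κAone ⊕ (κBone ⊕ κA) → LinearMap.ker (Finsupp.linearCombination (MvPolynomial σ K) b) :=
    Sum.elim (fun a => f1 (b1A a)) (Sum.elim (fun a => ⟨_, hlB a⟩) (fun c => ⟨_, hlA c⟩))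
  have hlinb : ∀ c, FrobLin1 (b1 c : κA ⊕ κB →₀ MvPolynomial σ K) := by
    rintro (c | c | c)
    · exact frobLin1_inL _ (lin1A c)
    · exact frobLin1_add _ _ (frobLin1_inL _ (fun a => isHomogeneous_zero _ _ _))
        (frobLin1_inR _ (lin1B c))
    · exact frobLin1_add _ _ (frobLin1_inL _ (frobLin1_single _ _ hx1.neg))
        (frobLin1_inR _ (hq1 c))
  refine ⟨κAone ⊕ (κBone ⊕ κA), b1, ?_, hlinb, ?_⟩
  · intro hfin
    have hfA := Finite.of_injective (Sum.inl : κA → κA ⊕ κB) Sum.inl_injective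
    have := fin1A hfA
    have := fin1B (Finite.of_injective (Sum.inr : κB → κA ⊕ κB) Sum.inr_injective)
    infer_instance
  · refine FrobQ.ext _ _ _ κAone (κBone ⊕ κA) b1A bY b1 f1 g1 ?_ ?_ ?_ (fun a => rfl) ?_
      (frob_homKer_sub _ _ hlinb) Q1A QY
    · intro z w h
      apply Subtype.ext
      have := congrArg (fun t => frobPrL κA κB (Subtype.val t)) h
      simpa only [hcoe, frobPrL_inL] using this
    · rintro ⟨r, hr⟩
      rw [hY, hψ] at hr
      obtain ⟨p, hp⟩ := sA ⟨_, A.neg_mem (A.mul_mem_left x hr)⟩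
      refine ⟨⟨_, hl p r ?_⟩, Subtype.ext ?_⟩
      · rw [hp]; simp
      · rw [hcoeg]
        dsimp only
        rw [map_add (frobPrR κA κB), frobPrR_inL, frobPrR_inR, zero_add]
    · intro z
      constructor
      · intro h
        have h0 : frobPrR κA κB (z : κA ⊕ κB →₀ MvPolynomial σ K) = 0 := congrArg Subtype.val h
        have hz := hsum z
        rw [LinearMap.mem_ker.1 z.2, h0, map_zero] at hz
        refine ⟨⟨frobPrL κA κB (z : κA ⊕ κB →₀ MvPolynomial σ K), ?_⟩, Subtype.ext ?_⟩
        · rw [LinearMap.mem_ker]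
          apply Subtype.ext
          simpa using hz.symm
        · rw [hcoe]
          conv_rhs => rw [frob_decomp (z : κA ⊕ κB →₀ MvPolynomial σ K), h0, map_zero, add_zero]
      · rintro ⟨w, rfl⟩
        apply Subtype.ext
        rw [hcoeg, hcoe, frobPrR_inL]; rfl
    · rintro (a | a)
      · exact Subtype.ext (hpr 0 _)
      · exact Subtype.ext (hpr _ _)

lemma frob_step {M : Type} [AddCommGroup M] [Module (MvPolynomial σ K) M] {κ : Type}
    {b : κ → M} (h : FrobQ K σ M κ b) : FrobStep K σ M κ b := by
  induction h with
  | free M κ b h => exact frob_step_free M κ b h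
  | ext M' M M'' κ' κ'' b' b'' b f g hf hg hfg hb' hb'' hker h' h'' i' i'' =>
    exact frob_step_ext M' M M'' κ' κ'' b' b'' b f g hf hg hfg hb' hb'' hker i' i''
  | split A B I x hx1 e κA κB bA bB b hAB hx hI hbA hbB hA hB h' h'' i' i'' =>
    exact frob_step_split A B I x hx1 e κA κB bA bB b hAB hx hI hbA hbB hA hB h' i' i''

variable (K σ) in
/-- A stage of the resolution. -/
structure FrobState where
  M : Type
  [i1 : AddCommGroup M]
  [i2 : Module (MvPolynomial σ K) M]
  κ : Type
  fin : Finite κ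
  b : κ → M
  hQ : FrobQ K σ M κ b

attribute [instance] FrobState.i1 FrobState.i2

/-- The map of free modules at a stage. -/
noncomputable abbrev FrobState.φ (s : FrobState K σ) :
    (s.κ →₀ MvPolynomial σ K) →ₗ[MvPolynomial σ K] s.M :=
  Finsupp.linearCombination (MvPolynomial σ K) s.b

/-- The next stage. -/
noncomputable def FrobState.next (s : FrobState K σ) : FrobState K σ where
  M := LinearMap.ker s.φ
  κ := (frob_step s.hQ).2.choose
  fin := (frob_step s.hQ).2.choose_spec.choose_spec.1 s.fin
  b := (frob_step s.hQ).2.choose_spec.choose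
  hQ := (frob_step s.hQ).2.choose_spec.choose_spec.2.2

/-- The differential from the next stage to this stage. -/
noncomputable def FrobState.diff (s : FrobState K σ) :
    (s.next.κ →₀ MvPolynomial σ K) →ₗ[MvPolynomial σ K] (s.κ →₀ MvPolynomial σ K) :=
  (LinearMap.ker s.φ).subtype.comp (show (s.next.κ →₀ MvPolynomial σ K) →ₗ[MvPolynomial σ K]
    LinearMap.ker s.φ from s.next.φ)

lemma FrobState.ker_diff (s : FrobState K σ) : LinearMap.ker s.diff = LinearMap.ker s.next.φ := by
  unfold FrobState.diff
  rw [LinearMap.ker_comp, Submodule.ker_subtype]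
  rfl

lemma FrobState.range_diff (s : FrobState K σ) :
    LinearMap.range s.diff = LinearMap.ker s.φ := by
  unfold FrobState.diff
  rw [LinearMap.range_comp_of_range_eq_top, Submodule.range_subtype]
  exact LinearMap.range_eq_top.2 (frob_step s.next.hQ).1

lemma FrobState.lin_diff (s : FrobState K σ) (c : s.next.κ) :
    FrobLin1 (s.diff (Finsupp.single c 1)) := by
  have h0 : s.next.φ (Finsupp.single c 1) = s.next.b c := by
    rw [Finsupp.linearCombination_single, one_smul]
  have h : s.diff (Finsupp.single c 1) =
      (LinearMap.ker s.φ).subtype ((frob_step s.hQ).2.choose_spec.choose c) :=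
    congrArg (LinearMap.ker s.φ).subtype h0
  rw [h]
  exact (frob_step s.hQ).2.choose_spec.choose_spec.2.1 c

/-- The sequence of stages. -/
noncomputable def FrobState.seq (s : FrobState K σ) : ℕ → FrobState K σ
  | 0 => s
  | n + 1 => (FrobState.seq s n).next

/-- `I` has `e`-linear generators in the class. -/
def FrobLinIdeal (e : ℕ) (I : Ideal (MvPolynomial σ K)) : Prop :=
  ∃ (κ : Type) (b : κ → I), Finite κ ∧ (∀ a, (b a : MvPolynomial σ K).IsHomogeneous e) ∧
    FrobQ K σ I κ b

lemma frob_lin_res {e : ℕ} {I : Ideal (MvPolynomial σ K)} (h : FrobLinIdeal e I) :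
    HasLinearResolution I e := by
  obtain ⟨κ, b, hfin, hb, hQ⟩ := h
  let s : FrobState K σ := { M := I, κ := κ, fin := hfin, b := b, hQ := hQ }
  refine ⟨{
    ι := fun i => (s.seq i).κ
    finite := fun i => (s.seq i).fin
    deg := fun i _ => i + e
    d := fun i => (s.seq i).diff
    ε := (Submodule.subtype I).comp (Finsupp.linearCombination (MvPolynomial σ K) b)
    range_ε := ?_
    exact_ε := ?_
    exact_d := ?_
    homog_ε := ?_
    homog_d := ?_
    minimal := ?_ }, ?_⟩
  · rw [LinearMap.range_comp_of_range_eq_top, Submodule.range_subtype]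
    exact LinearMap.range_eq_top.2 (frob_step hQ).1
  · have e1 : LinearMap.ker ((Submodule.subtype I).comp
        (Finsupp.linearCombination (MvPolynomial σ K) b)) =
        LinearMap.ker (Finsupp.linearCombination (MvPolynomial σ K) b) := by
      rw [LinearMap.ker_comp, Submodule.ker_subtype]
      rfl
    exact e1.trans (FrobState.range_diff s).symm
  · intro i
    exact (FrobState.ker_diff (s.seq i)).trans (FrobState.range_diff (s.seq i).next).symm
  · have : ∀ c : κ, (((Submodule.subtype I).comp
        (Finsupp.linearCombination (MvPolynomial σ K) b)) (Finsupp.single c 1)).IsHomogeneous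
        (0 + e) := by
      intro c
      rw [LinearMap.comp_apply, Finsupp.linearCombination_single, one_smul, zero_add]
      exact hb c
    exact this
  · intro i c a
    right
    refine ⟨by omega, ?_⟩
    have : i + 1 + e - (i + e) = 1 := by omega
    rw [this]
    exact (s.seq i).lin_diff c a
  · intro i c a
    have := (s.seq i).lin_diff c a
    rw [constantCoeff_eq]
    exact this.coeff_eq_zero (by simp)
  · intro i j h
    by_contra hne
    apply h
    unfold MinimalGradedFreeResolution.betti
    have : IsEmpty {b : (s.seq i).κ // i + e = j} := ⟨fun x => hne x.2.symm⟩
    exact Nat.card_of_isEmpty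

lemma frob_lin_split {e : ℕ} (A B : Ideal (MvPolynomial σ K)) (x : MvPolynomial σ K)
    (hx1 : x.IsHomogeneous 1) (hAB : A ≤ B) (hx : ∀ f, x * f ∈ A → f ∈ A)
    (hA : FrobLinIdeal (e+1) A) (hB : FrobLinIdeal e B) :
    FrobLinIdeal (e+1) (A ⊔ Ideal.span {x} * B) := by
  obtain ⟨κA, bA, finA, homA, QA⟩ := hA
  obtain ⟨κB, bB, finB, homB, QB⟩ := hB
  refine ⟨κA ⊕ κB, Sum.elim (fun a => ⟨bA a, Ideal.mem_sup_left (bA a).2⟩)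
    (fun a => ⟨x * bB a, Ideal.mem_sup_right
      (Ideal.mul_mem_mul (Ideal.mem_span_singleton_self x) (bB a).2)⟩), inferInstance, ?_, ?_⟩
  · rintro (a | a)
    · exact homA a
    · rw [add_comm]
      exact hx1.mul (homB a)
  · exact FrobQ.split A B _ x hx1 e κA κB bA bB _ hAB hx rfl (fun a => rfl) (fun a => rfl)
      homA homB QA QB

lemma frob_lin_bot (e : ℕ) : FrobLinIdeal e (⊥ : Ideal (MvPolynomial σ K)) := by
  refine ⟨Empty, fun a => a.elim, inferInstance, fun a => a.elim, FrobQ.free _ _ _ ?_⟩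
  exact ⟨Function.injective_of_subsingleton _, fun m => ⟨0, Subsingleton.elim _ _⟩⟩

lemma frob_lin_top : FrobLinIdeal 0 (⊤ : Ideal (MvPolynomial σ K)) := by
  refine ⟨Unit, fun _ => ⟨1, trivial⟩, inferInstance, fun _ => isHomogeneous_one _ _,
    FrobQ.free _ _ _ ⟨?_, ?_⟩⟩
  · intro z w h
    have h' := congrArg Subtype.val h
    rw [frob_coe_lc, frob_coe_lc] at h'
    refine Finsupp.ext fun a => ?_
    simpa [Finsupp.linearCombination_apply, Finsupp.sum_fintype] using h'
  · rintro ⟨m, hm⟩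
    refine ⟨Finsupp.single () m, Subtype.ext ?_⟩
    rw [frob_coe_lc, Finsupp.linearCombination_single]
    simp

end FrobAlg2


section FrobDir1

variable {K : Type} [Field K] {σ : Type}

lemma frob_single_mul_mem (A : Set (σ →₀ ℕ)) (v : σ) (hA : ∀ s ∈ A, s v = 0)
    (f : MvPolynomial σ K)
    (h : X v * f ∈ Ideal.span ((fun s => monomial s (1 : K)) '' A)) :
    f ∈ Ideal.span ((fun s => monomial s (1 : K)) '' A) := by
  rw [mem_ideal_span_monomial_image] at h ⊢
  intro t ht
  obtain ⟨s, hs, hle⟩ := h (Finsupp.single v 1 + t) (by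
    rw [mem_support_iff, coeff_X_mul]; exact mem_support_iff.1 ht)
  refine ⟨s, hs, fun w => ?_⟩
  by_cases hw : w = v
  · rw [hw, hA s hs]; exact Nat.zero_le _
  · have := hle w
    simpa [Finsupp.single_apply, Ne.symm hw] using this

lemma frob_vars (T : Finset σ) :
    FrobLinIdeal 1 (Ideal.span ((X : σ → MvPolynomial σ K) '' T)) := by
  classical
  induction T using Finset.induction_on with
  | empty => simpa using frob_lin_bot (K := K) (σ := σ) 1
  | insert t T ht ih =>
    have h := frob_lin_split (e := 0) _ ⊤ (X t) (isHomogeneous_X K t) le_top ?_ ih frob_lin_top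
    · convert h using 1
      rw [Finset.coe_insert, Set.image_insert_eq, Ideal.span_insert, sup_comm, Ideal.mul_top]
    · intro f hf
      have e : (X : σ → MvPolynomial σ K) '' (T : Set σ) =
          (fun s => monomial s (1 : K)) '' ((fun i => Finsupp.single i 1) '' (T : Set σ)) := by
        rw [Set.image_image]; rfl
      rw [e] at hf ⊢
      refine frob_single_mul_mem _ t ?_ f hf
      rintro _ ⟨i, hi, rfl⟩
      have : i ≠ t := fun h => ht (h ▸ hi)
      simp [this]

/-- Restricted edge ideal of the complement. -/
noncomputable def frobEdge (K : Type) [Field K] {σ : Type} (G : SimpleGraph σ) (U : Finset σ) :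
    Ideal (MvPolynomial σ K) :=
  Ideal.span {p | ∃ i ∈ U, ∃ j ∈ U, i ≠ j ∧ ¬ G.Adj i j ∧ p = X i * X j}

set_option maxHeartbeats 600000 in
lemma frob_edge_lin (G : SimpleGraph σ) (hs : ∀ U : Finset σ, U.Nonempty → ∃ w, FrobSimp G U w) :
    ∀ k (U : Finset σ), U.card = k → FrobLinIdeal 2 (frobEdge K G U) := by
  classical
  intro k
  induction k with
  | zero =>
    intro U hU
    rw [Finset.card_eq_zero] at hU
    subst hU
    have : frobEdge K G ∅ = ⊥ := by simp [frobEdge]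
    rw [this]
    exact frob_lin_bot 2
  | succ k ih =>
    intro U hU
    obtain ⟨v, hvU, hv⟩ := hs U (Finset.card_pos.1 (by omega))
    let T := U.filter (fun u => u ≠ v ∧ ¬ G.Adj v u)
    have hle : frobEdge K G (U.erase v) ≤ Ideal.span ((X : σ → MvPolynomial σ K) '' T) := by
      unfold frobEdge
      rw [Ideal.span_le]
      rintro _ ⟨i, hi, j, hj, hij, hadj, rfl⟩
      rw [Finset.mem_erase] at hi hj
      by_cases h1 : G.Adj v i
      · have h2 : ¬ G.Adj v j := fun h2 => hadj (hv i hi.2 j hj.2 hij h1 h2)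
        refine Ideal.mul_mem_left _ _ (Ideal.subset_span ⟨j, ?_, rfl⟩)
        simp [T, hj, h2]
      · refine Ideal.mul_mem_right _ _ (Ideal.subset_span ⟨i, ?_, rfl⟩)
        simp [T, hi, h1]
    have h := frob_lin_split (e := 1) (frobEdge K G (U.erase v)) _ (X v) (isHomogeneous_X K v) hle ?_
      (ih _ (by rw [Finset.card_erase_of_mem hvU]; omega)) (frob_vars T)
    · convert h using 1
      apply le_antisymm
      · conv_lhs => unfold frobEdge
        rw [Ideal.span_le]
        rintro _ ⟨i, hi, j, hj, hij, hadj, rfl⟩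
        by_cases h1 : i = v
        · subst h1
          exact Ideal.mem_sup_right (Ideal.mul_mem_mul (Ideal.mem_span_singleton_self _)
            (Ideal.subset_span ⟨j, by simp [T, hj, hij.symm, hadj], rfl⟩))
        by_cases h2 : j = v
        · subst h2
          have hT : i ∈ (T : Set σ) := by
            have h3 : ¬ G.Adj j i := fun h => hadj h.symm
            simp [T, hi, hij, h3]
          rw [mul_comm (X i) (X j)]
          exact Ideal.mem_sup_right (Ideal.mul_mem_mul (Ideal.mem_span_singleton_self _)
            (Ideal.subset_span ⟨i, hT, rfl⟩))
        · exact Ideal.mem_sup_left (Ideal.subset_span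
            ⟨i, by simp [hi, h1], j, by simp [hj, h2], hij, hadj, rfl⟩)
      · apply sup_le
        · apply Ideal.span_mono
          rintro _ ⟨i, hi, j, hj, hij, hadj, rfl⟩
          exact ⟨i, Finset.mem_of_mem_erase hi, j, Finset.mem_of_mem_erase hj, hij, hadj, rfl⟩
        · rw [Ideal.span_mul_span', Ideal.span_le]
          rintro _ ⟨_, rfl, _, ⟨j, hj, rfl⟩, rfl⟩
          simp only [T, Finset.coe_filter, Set.mem_ofPred_eq] at hj
          exact Ideal.subset_span ⟨v, hvU, j, hj.1, hj.2.1.symm, hj.2.2, rfl⟩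
    · intro f hf
      have e : frobEdge K G (U.erase v) = Ideal.span ((fun s => monomial s (1 : K)) ''
          {s | ∃ i ∈ U.erase v, ∃ j ∈ U.erase v, i ≠ j ∧ ¬ G.Adj i j ∧
            s = Finsupp.single i 1 + Finsupp.single j 1}) := by
        unfold frobEdge
        congr 1
        ext p
        constructor
        · rintro ⟨i, hi, j, hj, hij, hadj, rfl⟩
          refine ⟨_, ⟨i, hi, j, hj, hij, hadj, rfl⟩, ?_⟩
          simp [X, monomial_mul]
        · rintro ⟨_, ⟨i, hi, j, hj, hij, hadj, rfl⟩, rfl⟩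
          refine ⟨i, hi, j, hj, hij, hadj, ?_⟩
          simp [X, monomial_mul]
      rw [e] at hf ⊢
      refine frob_single_mul_mem _ v ?_ f hf
      rintro _ ⟨i, hi, j, hj, hij, hadj, rfl⟩
      have h1 := Finset.ne_of_mem_erase hi
      have h2 := Finset.ne_of_mem_erase hj
      simp [h1, h2]

lemma frob_dir1 (n : ℕ) (G : SimpleGraph (Fin n)) (h : IsChordal G) :
    HasLinearResolution (edgeIdeal K Gᶜ) 2 := by
  apply frob_lin_res
  have h1 := frob_edge_lin (K := K) G (fun U hU => (frob_dirac G h _ U rfl).1 hU) _ Finset.univ rfl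
  convert h1 using 1
  unfold edgeIdeal frobEdge
  congr 1
  ext p
  simp [SimpleGraph.compl_adj, and_assoc]

end FrobDir1


section FrobDir2

variable {K : Type} [Field K] {n : ℕ}

/-- The Koszul sign. -/
noncomputable def frobSg (K : Type) [Field K] {n : ℕ} (B : Finset (Fin n)) (a : Fin n) : K :=
  (-1) ^ (B.filter (fun b => b < a)).card

lemma frobSg_sq (B : Finset (Fin n)) (a : Fin n) : frobSg K B a * frobSg K B a = 1 := by
  unfold frobSg
  rw [← pow_add, ← two_mul, pow_mul]
  simp

lemma frobSg_anti (B : Finset (Fin n)) (a b : Fin n) (ha : a ∉ B) (hb : b ∉ B) (hab : a ≠ b) :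
    frobSg K B a * frobSg K (insert a B) b = - (frobSg K B b * frobSg K (insert b B) a) := by
  unfold frobSg
  rw [Finset.filter_insert, Finset.filter_insert]
  rcases lt_or_gt_of_ne hab with h | h
  · rw [if_pos h, if_neg (not_lt.2 h.le), Finset.card_insert_of_notMem (by simp [ha])]
    ring
  · rw [if_neg (not_lt.2 h.le), if_pos h, Finset.card_insert_of_notMem (by simp [hb])]
    ring

variable {M N : Type} [AddCommGroup M] [Module (MvPolynomial (Fin n) K) M]
  [AddCommGroup N] [Module (MvPolynomial (Fin n) K) N]

/-- The Koszul differential with coefficients in `M`. -/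
noncomputable def frobKos (K : Type) [Field K] {n : ℕ} {M : Type} [AddCommGroup M]
    [Module (MvPolynomial (Fin n) K) M] (c : Finset (Fin n) → M) (B : Finset (Fin n)) : M :=
  ∑ a ∈ Bᶜ, (C (frobSg K B a) * X a : MvPolynomial (Fin n) K) • c (insert a B)

lemma frobKos_map (f : M →ₗ[MvPolynomial (Fin n) K] N) (c : Finset (Fin n) → M)
    (B : Finset (Fin n)) : frobKos K (fun B => f (c B)) B = f (frobKos K c B) := by
  unfold frobKos
  rw [map_sum]
  exact Finset.sum_congr rfl fun a _ => (map_smul f _ _).symm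

lemma frobKos_sub (c c' : Finset (Fin n) → M) (B : Finset (Fin n)) :
    frobKos K (fun B => c B - c' B) B = frobKos K c B - frobKos K c' B := by
  unfold frobKos
  rw [← Finset.sum_sub_distrib]
  exact Finset.sum_congr rfl fun a _ => smul_sub _ _ _

lemma frobKos_add (c c' : Finset (Fin n) → M) (B : Finset (Fin n)) :
    frobKos K (fun B => c B + c' B) B = frobKos K c B + frobKos K c' B := by
  unfold frobKos
  rw [← Finset.sum_add_distrib]
  exact Finset.sum_congr rfl fun a _ => smul_add _ _ _

lemma frobKos_kos (c : Finset (Fin n) → M) (B : Finset (Fin n)) :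
    frobKos K (frobKos K c) B = 0 := by
  have e : frobKos K (frobKos K c) B = ∑ p ∈ Bᶜ.sigma (fun a => (insert a B)ᶜ),
      (C (frobSg K B p.1) * X p.1 : MvPolynomial (Fin n) K) •
        (C (frobSg K (insert p.1 B) p.2) * X p.2 : MvPolynomial (Fin n) K) •
          c (insert p.2 (insert p.1 B)) := by
    unfold frobKos
    rw [Finset.sum_sigma]
    exact Finset.sum_congr rfl fun a _ => Finset.smul_sum
  rw [e]
  refine Finset.sum_involution (fun p _ => ⟨p.2, p.1⟩) ?_ ?_ ?_ ?_
  · rintro ⟨a, b⟩ hp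
    simp only [Finset.mem_sigma, Finset.mem_compl, Finset.mem_insert, not_or] at hp
    have h := frobSg_anti (K := K) B a b hp.1 hp.2.2 (Ne.symm hp.2.1)
    simp only [smul_smul]
    rw [Finset.insert_comm b a, ← add_smul]
    have : (C (frobSg K B a) * X a * (C (frobSg K (insert a B) b) * X b) +
      C (frobSg K B b) * X b * (C (frobSg K (insert b B) a) * X a) : MvPolynomial (Fin n) K)
      = C (frobSg K B a * frobSg K (insert a B) b + frobSg K B b * frobSg K (insert b B) a)
        * (X a * X b) := by
      simp only [C_add, C_mul]; ring
    rw [this, h]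
    simp
  · rintro ⟨a, b⟩ hp _ h
    simp only [Finset.mem_sigma, Finset.mem_compl, Finset.mem_insert, not_or] at hp
    simp only [Sigma.mk.injEq] at h
    exact hp.2.1 h.1
  · rintro ⟨a, b⟩ hp
    simp only [Finset.mem_sigma, Finset.mem_compl, Finset.mem_insert, not_or] at hp ⊢
    exact ⟨hp.2.2, Ne.symm hp.2.1, hp.1⟩
  · rintro ⟨a, b⟩ hp
    rfl

lemma frob_lin_eq (p : MvPolynomial (Fin n) K) (hp : p.IsHomogeneous 1) :
    p = ∑ a, C (coeff (Finsupp.single a 1) p) * X a := by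
  ext d
  rw [coeff_sum]
  simp only [coeff_C_mul, coeff_X]
  by_cases hd : d.degree = 1
  · obtain ⟨a, rfl⟩ : ∃ a, d = Finsupp.single a 1 :=
      (Finsupp.sum_eq_one_iff d).1 hd
    rw [Finset.sum_eq_single a]
    · simp
    · intro b _ hb
      simp [Finsupp.single_left_inj, hb]
    · simp
  · rw [hp.coeff_eq_zero hd, Finset.sum_eq_zero]
    intro a _
    rw [if_neg, mul_zero]
    rintro rfl
    simp at hd

/-- coefficient of the Koszul differential -/
lemma frobKos_coeff (c : Finset (Fin n) → MvPolynomial (Fin n) K) (B : Finset (Fin n))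
    (d : Fin n →₀ ℕ) : coeff d (frobKos K c B) =
      ∑ a ∈ Bᶜ, if a ∈ d.support then
        frobSg K B a * coeff (d - Finsupp.single a 1) (c (insert a B)) else 0 := by
  unfold frobKos
  rw [coeff_sum]
  refine Finset.sum_congr rfl fun a _ => ?_
  rw [smul_eq_mul, mul_assoc, coeff_C_mul, coeff_X_mul']
  split_ifs <;> simp

lemma frobKos_pair (c : Finset (Fin n) → MvPolynomial (Fin n) K) (B : Finset (Fin n))
    (a b : Fin n) (ha : a ∉ B) (hb : b ∉ B) (hab : a ≠ b) :
    coeff (Finsupp.single a 1 + Finsupp.single b 1) (frobKos K c B) =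
      frobSg K B a * coeff (Finsupp.single b 1) (c (insert a B)) +
      frobSg K B b * coeff (Finsupp.single a 1) (c (insert b B)) := by
  rw [frobKos_coeff, ← Finset.sum_subset (s₁ := {a, b})]
  · rw [Finset.sum_pair hab, if_pos (by simp), if_pos (by simp), add_tsub_cancel_left,
      add_tsub_cancel_right]
  · intro x hx
    simp only [Finset.mem_insert, Finset.mem_singleton] at hx
    rcases hx with rfl | rfl <;> simpa
  · intro x _ hx
    simp only [Finset.mem_insert, Finset.mem_singleton, not_or] at hx
    rw [if_neg]
    simp [Ne.symm hx.1, Ne.symm hx.2]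

lemma frobKos_diag (c : Finset (Fin n) → MvPolynomial (Fin n) K) (B : Finset (Fin n))
    (a : Fin n) (ha : a ∉ B) :
    coeff (Finsupp.single a 1 + Finsupp.single a 1) (frobKos K c B) =
      frobSg K B a * coeff (Finsupp.single a 1) (c (insert a B)) := by
  rw [frobKos_coeff, Finset.sum_eq_single a]
  · rw [if_pos (by simp), add_tsub_cancel_left]
  · intro x _ hx
    rw [if_neg]
    simp [Ne.symm hx]
  · simp [ha]

lemma frobKos_triple (c : Finset (Fin n) → MvPolynomial (Fin n) K) (B : Finset (Fin n))
    (a b e : Fin n) (ha : a ∉ B) (hb : b ∉ B) (he : e ∉ B) (hab : a ≠ b) (hbe : b ≠ e)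
    (hae : a ≠ e) :
    coeff (Finsupp.single a 1 + Finsupp.single b 1 + Finsupp.single e 1) (frobKos K c B) =
      frobSg K B a * coeff (Finsupp.single b 1 + Finsupp.single e 1) (c (insert a B)) +
      (frobSg K B b * coeff (Finsupp.single e 1 + Finsupp.single a 1) (c (insert b B)) +
      frobSg K B e * coeff (Finsupp.single a 1 + Finsupp.single b 1) (c (insert e B))) := by
  rw [frobKos_coeff, ← Finset.sum_subset (s₁ := {a, b, e})]
  · rw [Finset.sum_insert (by simp [hab, hae]), Finset.sum_pair hbe, if_pos (by simp),
      if_pos (by simp), if_pos (by simp), add_tsub_cancel_right]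
    congr 3
    · rw [add_assoc, add_tsub_cancel_left]
    · congr 2
      rw [add_right_comm, add_tsub_cancel_right, add_comm]
  · intro x hx
    simp only [Finset.mem_insert, Finset.mem_singleton] at hx
    rcases hx with rfl | rfl | rfl <;> simpa
  · intro x _ hx
    simp only [Finset.mem_insert, Finset.mem_singleton, not_or] at hx
    rw [if_neg]
    simp [Ne.symm hx.1, Ne.symm hx.2.1, Ne.symm hx.2.2]

/-- Exactness of the linear part of the Koszul complex. -/
lemma frob_kos_exact (z : Finset (Fin n) → MvPolynomial (Fin n) K)
    (hz : ∀ B, (z B).IsHomogeneous 1) (h0 : ∀ B, frobKos K z B = 0) :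
    ∃ y : Finset (Fin n) → MvPolynomial (Fin n) K, (∀ B, (y B).IsHomogeneous 0) ∧
      ∀ B, frobKos K y B = z B := by
  classical
  have hdiag : ∀ B a, a ∈ B → coeff (Finsupp.single a 1) (z B) = 0 := by
    intro B a ha
    have h := frobKos_diag z (B.erase a) a (Finset.notMem_erase a B)
    rw [h0, Finset.insert_erase ha, coeff_zero] at h
    have hs := frobSg_sq (K := K) (B.erase a) a
    have : frobSg K (B.erase a) a ≠ 0 := left_ne_zero_of_mul_eq_one hs
    exact (mul_eq_zero.1 h.symm).resolve_left this
  have hwd : ∀ B a b, a ∉ B → b ∉ B → a ≠ b →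
      frobSg K (insert a B) b * coeff (Finsupp.single b 1) (z (insert a B)) =
      frobSg K (insert b B) a * coeff (Finsupp.single a 1) (z (insert b B)) := by
    intro B a b ha hb hab
    have h := frobKos_pair z B a b ha hb hab
    rw [h0, coeff_zero] at h
    have h1 := frobSg_anti (K := K) B a b ha hb hab
    have h2 := frobSg_sq (K := K) B a
    have h3 := frobSg_sq (K := K) B b
    generalize coeff (Finsupp.single b 1) (z (insert a B)) = u at *
    generalize coeff (Finsupp.single a 1) (z (insert b B)) = v at *
    generalize frobSg K (insert a B) b = p at *
    generalize frobSg K (insert b B) a = q at *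
    generalize frobSg K B a = r at *
    generalize frobSg K B b = s at *
    linear_combination (-p * u) * h2 - r * p * h - (s * v) * h1 + q * v * h3
  let y : Finset (Fin n) → MvPolynomial (Fin n) K := fun D =>
    if h : D.Nonempty then
      C (frobSg K (D.erase h.choose) h.choose *
        coeff (Finsupp.single h.choose 1) (z (D.erase h.choose))) else 0
  have hy : ∀ B a, a ∉ B → y (insert a B) =
      C (frobSg K B a * coeff (Finsupp.single a 1) (z B)) := by
    intro B a ha
    have hne : (insert a B).Nonempty := Finset.insert_nonempty a B
    have e : y (insert a B) = C (frobSg K ((insert a B).erase hne.choose) hne.choose *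
        coeff (Finsupp.single hne.choose 1) (z ((insert a B).erase hne.choose))) := dif_pos hne
    rw [e]
    have hmem := hne.choose_spec
    generalize hne.choose = b at hmem
    by_cases hb : b = a
    · subst hb
      rw [Finset.erase_insert ha]
    · have hbB : b ∈ B := (Finset.mem_insert.1 hmem).resolve_left hb
      have e1 : (insert a B).erase b = insert a (B.erase b) := by
        rw [Finset.erase_insert_of_ne (Ne.symm hb)]
      have e2 : B = insert b (B.erase b) := (Finset.insert_erase hbB).symm
      rw [e1]
      conv_rhs => rw [e2]
      rw [hwd (B.erase b) a b (fun h => ha (Finset.mem_of_mem_erase h))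
        (Finset.notMem_erase b B) (Ne.symm hb)]
  refine ⟨y, ?_, ?_⟩
  · intro D
    simp only [y]
    split_ifs
    · exact isHomogeneous_C _ _
    · exact isHomogeneous_zero _ _ _
  · intro B
    rw [frob_lin_eq (z B) (hz B)]
    unfold frobKos
    have e : ∑ a, C (coeff (Finsupp.single a 1) (z B)) * (X a : MvPolynomial (Fin n) K) =
        ∑ a ∈ Bᶜ, C (coeff (Finsupp.single a 1) (z B)) * (X a : MvPolynomial (Fin n) K) := by
      symm
      apply Finset.sum_subset (Finset.subset_univ _)
      intro a _ ha
      rw [hdiag B a (by simpa using ha)]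
      simp
    rw [e]
    refine Finset.sum_congr rfl fun a ha => ?_
    rw [hy B a (by simpa using ha), smul_eq_mul, C_mul]
    have := congrArg (C (σ := Fin n)) (frobSg_sq (K := K) B a)
    rw [C_mul, C_1] at this
    linear_combination (C (coeff (Finsupp.single a 1) (z B)) * X a) * this

end FrobDir2


section FrobDir2b

variable {K : Type} [Field K] {n : ℕ}

lemma frobKos_apply {κ : Type} (c : Finset (Fin n) → (κ →₀ MvPolynomial (Fin n) K))
    (B : Finset (Fin n)) (a : κ) : frobKos K c B a = frobKos K (fun B => c B a) B :=
  (frobKos_map (Finsupp.lapply a) c B).symm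

lemma frob_kos_exact_free {κ : Type} [Finite κ]
    (z : Finset (Fin n) → (κ →₀ MvPolynomial (Fin n) K))
    (hz : ∀ B, FrobLin1 (z B)) (h0 : ∀ B, frobKos K z B = 0) :
    ∃ y : Finset (Fin n) → (κ →₀ MvPolynomial (Fin n) K), (∀ B a, (y B a).IsHomogeneous 0) ∧
      ∀ B, frobKos K y B = z B := by
  have h : ∀ a : κ, ∃ y : Finset (Fin n) → MvPolynomial (Fin n) K,
      (∀ B, (y B).IsHomogeneous 0) ∧ ∀ B, frobKos K y B = z B a := by
    intro a
    refine frob_kos_exact (fun B => z B a) (fun B => hz B a) (fun B => ?_)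
    rw [← frobKos_apply, h0]
    rfl
  choose y hy1 hy2 using h
  refine ⟨fun B => Finsupp.equivFunOnFinite.symm (fun a => y a B), fun B a => hy1 a B, ?_⟩
  intro B
  refine Finsupp.ext fun a => ?_
  rw [frobKos_apply]
  exact hy2 a B

lemma frob_kos_hom (c : Finset (Fin n) → MvPolynomial (Fin n) K) (e : ℕ)
    (hc : ∀ B, (c B).IsHomogeneous e) (B : Finset (Fin n)) :
    (frobKos K c B).IsHomogeneous (e + 1) := by
  unfold frobKos
  refine IsHomogeneous.sum _ _ _ fun a _ => ?_
  have h := ((isHomogeneous_C (Fin n) (frobSg K B a)).mul (isHomogeneous_X K a)).mul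
    (hc (insert a B))
  rw [smul_eq_mul]
  convert h using 1
  omega

lemma frob_eq_lc {κ M : Type} [AddCommGroup M] [Module (MvPolynomial (Fin n) K) M]
    (f : (κ →₀ MvPolynomial (Fin n) K) →ₗ[MvPolynomial (Fin n) K] M) (z) :
    f z = Finsupp.linearCombination (MvPolynomial (Fin n) K) (fun b => f (Finsupp.single b 1)) z := by
  rw [Finsupp.linearCombination_apply]
  conv_lhs => rw [← Finsupp.sum_single z, Finsupp.sum, map_sum]
  refine Finset.sum_congr rfl fun b _ => ?_
  dsimp only
  rw [← map_smul, Finsupp.smul_single, smul_eq_mul, mul_one]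

lemma frob_map_comp {κ κ' : Type}
    (f : (κ →₀ MvPolynomial (Fin n) K) →ₗ[MvPolynomial (Fin n) K] (κ' →₀ MvPolynomial (Fin n) K))
    (hf : ∀ b, FrobLin1 (f (Finsupp.single b 1))) (j : ℕ) (z) :
    f (frobComp j z) = frobComp (j + 1) (f z) := by
  refine Finsupp.ext fun c => ?_
  rw [frob_eq_lc f (frobComp j z), frob_eq_lc f z, frob_lc_apply, frob_lc_comp _ 1 (fun b => hf b c),
    ← frob_lc_apply]
  rfl

lemma frob_comp_self {κ : Type} (j : ℕ) (z : κ →₀ MvPolynomial (Fin n) K)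
    (hz : ∀ a, (z a).IsHomogeneous j) : frobComp j z = z :=
  Finsupp.ext fun a => homogeneousComponent_eq_self (hz a)

lemma frob_comp_hom {κ : Type} (j : ℕ) (z : κ →₀ MvPolynomial (Fin n) K) (a : κ) :
    (frobComp j z a).IsHomogeneous j := homogeneousComponent_isHomogeneous _ _

variable {I : Ideal (MvPolynomial (Fin n) K)}

lemma frob_chase (R : MinimalGradedFreeResolution I)
    (hd : ∀ i b, FrobLin1 (R.d i (Finsupp.single b 1))) :
    ∀ (r k : ℕ) (z : Finset (Fin n) → (R.ι k →₀ MvPolynomial (Fin n) K)),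
      (∀ B, FrobLin1 (z B)) → (∀ B, frobKos K z B ∈ LinearMap.range (R.d k)) →
      (∀ B, r ≤ B.card → z B = 0) →
      ∃ (y : Finset (Fin n) → (R.ι k →₀ MvPolynomial (Fin n) K))
        (y' : Finset (Fin n) → (R.ι (k + 1) →₀ MvPolynomial (Fin n) K)),
        (∀ B a, (y B a).IsHomogeneous 0) ∧ (∀ B a, (y' B a).IsHomogeneous 0) ∧
        ∀ B, z B = R.d k (y' B) + frobKos K y B := by
  intro r
  induction r with
  | zero =>
    intro k z _ _ hz
    refine ⟨fun _ => 0, fun _ => 0, fun _ _ => isHomogeneous_zero _ _ _,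
      fun _ _ => isHomogeneous_zero _ _ _, fun B => ?_⟩
    rw [hz B (Nat.zero_le _), map_zero, zero_add]
    unfold frobKos
    simp
  | succ r ih =>
    intro k z hz1 hzr hz0
    have hlift : ∀ B, ∃ q : R.ι (k + 1) →₀ MvPolynomial (Fin n) K, FrobLin1 q ∧
        R.d k q = frobKos K z B ∧ (r ≤ B.card → q = 0) := by
      intro B
      by_cases hB : r ≤ B.card
      · refine ⟨0, fun a => isHomogeneous_zero _ _ _, ?_, fun _ => rfl⟩
        rw [map_zero]
        symm
        unfold frobKos
        refine Finset.sum_eq_zero fun a ha => ?_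
        rw [hz0, smul_zero]
        rw [Finset.card_insert_of_notMem (by simpa using ha)]
        omega
      · obtain ⟨q, hq⟩ := hzr B
        refine ⟨frobComp 1 q, frob_comp_hom 1 q, ?_, fun h => absurd h hB⟩
        rw [frob_map_comp _ (hd k), hq]
        apply frob_comp_self
        intro a
        rw [frobKos_apply]
        exact frob_kos_hom _ 1 (fun B => hz1 B a) B
    choose z' hz'1 hz'2 hz'3 using hlift
    obtain ⟨y', y'', hy', hy'', hzz⟩ := ih (k + 1) z' hz'1 (by
      intro B
      rw [← R.exact_d k, LinearMap.mem_ker, ← frobKos_map]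
      have : (fun B => R.d k (z' B)) = frobKos K z := funext hz'2
      rw [this, frobKos_kos]) hz'3
    have hcyc : ∀ B, frobKos K (fun B => z B - R.d k (y' B)) B = 0 := by
      intro B
      have h1 : R.d k (R.d (k + 1) (y'' B)) = 0 := by
        rw [← LinearMap.mem_ker, R.exact_d k]
        exact LinearMap.mem_range_self _ _
      rw [frobKos_sub, frobKos_map, ← hz'2, hzz B, map_add, h1, zero_add, sub_self]
    have := R.finite k
    obtain ⟨y, hy, hyz⟩ := frob_kos_exact_free (fun B => z B - R.d k (y' B)) (by
      intro B a
      refine (hz1 B a).sub ?_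
      have h2 := frob_map_comp (R.d k) (hd k) 0 (y' B)
      rw [frob_comp_self 0 _ (hy' B)] at h2
      rw [h2]
      exact frob_comp_hom _ _ _) hcyc
    refine ⟨y, y', hy, hy', fun B => ?_⟩
    rw [hyz B]
    simp

/-- The key consequence of linearity: Koszul cycles of degree three coefficients bound. -/
lemma frob_kos_bound (h : HasLinearResolution I 2) (z : Finset (Fin n) → MvPolynomial (Fin n) K)
    (hz : ∀ B, (z B).IsHomogeneous 3) (hzI : ∀ B, z B ∈ I) (h0 : ∀ B, frobKos K z B = 0) :
    ∃ w : Finset (Fin n) → MvPolynomial (Fin n) K, (∀ B, w B ∈ I) ∧ ∀ B, frobKos K w B = z B := by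
  obtain ⟨R, hR⟩ := h
  have hdeg : ∀ i b, R.deg i b = i + 2 := by
    intro i b
    apply hR i
    unfold MinimalGradedFreeResolution.betti
    have := R.finite i
    have : Nonempty {c : R.ι i // R.deg i c = R.deg i b} := ⟨⟨b, rfl⟩⟩
    exact Nat.card_pos.ne'
  have hd : ∀ i b, FrobLin1 (R.d i (Finsupp.single b 1)) := by
    intro i b c
    rcases R.homog_d i b c with h | ⟨_, h⟩
    · rw [h]; exact isHomogeneous_zero _ _ _
    · rw [hdeg, hdeg] at h
      convert h using 1
      omega
  have he : ∀ b, (R.ε (Finsupp.single b 1)).IsHomogeneous 2 := by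
    intro b
    have := R.homog_ε b
    rw [hdeg] at this
    exact this
  have hlift : ∀ B, ∃ q : R.ι 0 →₀ MvPolynomial (Fin n) K, FrobLin1 q ∧ R.ε q = z B := by
    intro B
    have h1 := hzI B
    rw [← R.range_ε] at h1
    obtain ⟨q, hq⟩ := h1
    refine ⟨frobComp 1 q, frob_comp_hom 1 q, ?_⟩
    rw [frob_eq_lc, frob_lc_comp _ 2 he, ← frob_eq_lc, hq]
    exact homogeneousComponent_eq_self (hz B)
  choose z0 hz01 hz02 using hlift
  obtain ⟨y, y', _, _, hy⟩ := frob_chase R hd (n + 1) 0 z0 hz01 (by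
    intro B
    rw [← R.exact_ε, LinearMap.mem_ker, ← frobKos_map]
    have : (fun B => R.ε (z0 B)) = z := funext hz02
    rw [this, h0]) (by
    intro B hB
    have := Finset.card_le_univ B
    rw [Fintype.card_fin] at this
    omega)
  refine ⟨fun B => R.ε (y B), fun B => ?_, fun B => ?_⟩
  · have h2 : R.ε (y B) ∈ LinearMap.range R.ε := LinearMap.mem_range_self _ _
    exact R.range_ε.le h2
  · have h1 : R.ε (R.d 0 (y' B)) = 0 := by
      rw [← LinearMap.mem_ker, R.exact_ε]
      exact LinearMap.mem_range_self _ _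
    rw [frobKos_map, ← hz02 B, hy B, map_add, h1, zero_add]

end FrobDir2b


section FrobDir2c

variable {K : Type} [Field K] {n : ℕ}

lemma frob_coeff_edge (G : SimpleGraph (Fin n)) (p : MvPolynomial (Fin n) K)
    (hp : p ∈ edgeIdeal K Gᶜ) (a b : Fin n) (hab : G.Adj a b) :
    coeff (Finsupp.single a 1 + Finsupp.single b 1) p = 0 := by
  classical
  have e : edgeIdeal K Gᶜ = Ideal.span ((fun s => monomial s (1 : K)) ''
      {s | ∃ i j, Gᶜ.Adj i j ∧ s = Finsupp.single i 1 + Finsupp.single j 1}) := by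
    unfold edgeIdeal
    congr 1
    ext p
    constructor
    · rintro ⟨i, j, hadj, rfl⟩
      refine ⟨_, ⟨i, j, hadj, rfl⟩, ?_⟩
      simp [X, monomial_mul]
    · rintro ⟨_, ⟨i, j, hadj, rfl⟩, rfl⟩
      refine ⟨i, j, hadj, ?_⟩
      simp [X, monomial_mul]
  rw [e, mem_ideal_span_monomial_image] at hp
  by_contra hne
  obtain ⟨_, ⟨i, j, hij, rfl⟩, hle⟩ := hp _ (mem_support_iff.2 hne)
  rw [SimpleGraph.compl_adj] at hij
  have hi : i = a ∨ i = b := by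
    by_contra hcon
    push Not at hcon
    have := hle i
    simp [Finsupp.single_apply, Ne.symm hcon.1, Ne.symm hcon.2] at this
  have hj : j = a ∨ j = b := by
    by_contra hcon
    push Not at hcon
    have := hle j
    simp [Finsupp.single_apply, Ne.symm hcon.1, Ne.symm hcon.2] at this
  rcases hi with rfl | rfl <;> rcases hj with rfl | rfl
  · exact hij.1 rfl
  · exact hij.2 hab
  · exact hij.2 hab.symm
  · exact hij.1 rfl

/-- signed coefficient of a Koszul chain on pairs in `W` -/
noncomputable def frobG (v : Finset (Fin n) → MvPolynomial (Fin n) K) (W : Finset (Fin n))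
    (a b : Fin n) : K :=
  frobSg K ((W.erase a).erase b) a * frobSg K (insert a ((W.erase a).erase b)) b *
    coeff (Finsupp.single a 1 + Finsupp.single b 1) (v ((W.erase a).erase b))

lemma frobG_anti (v : Finset (Fin n) → MvPolynomial (Fin n) K) (W : Finset (Fin n))
    (a b : Fin n) (hab : a ≠ b) : frobG v W b a = - frobG v W a b := by
  unfold frobG
  rw [Finset.erase_right_comm (a := b) (b := a), frobSg_anti _ a b (by simp) (by simp) hab,
    add_comm (Finsupp.single b 1)]
  ring

lemma frobG_triple (v : Finset (Fin n) → MvPolynomial (Fin n) K) (W : Finset (Fin n))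
    (hv : ∀ B, frobKos K v B = 0)
    (a b c : Fin n) (ha : a ∈ W) (hb : b ∈ W) (hc : c ∈ W) (hab : a ≠ b) (hbc : b ≠ c)
    (hac : a ≠ c) :
    frobG v W a b + frobG v W b c + frobG v W c a = 0 := by
  obtain ⟨B, haB, hbB, hcB, hW⟩ : ∃ B, a ∉ B ∧ b ∉ B ∧ c ∉ B ∧
      W = insert a (insert b (insert c B)) := by
    refine ⟨((W.erase a).erase b).erase c, by simp, by simp, by simp, ?_⟩
    ext x
    by_cases h1 : x = a <;> by_cases h2 : x = b <;> by_cases h3 : x = c <;> simp_all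
  have e1 : (W.erase a).erase b = insert c B := by
    rw [hW]; ext x
    by_cases h1 : x = a <;> by_cases h2 : x = b <;> by_cases h3 : x = c <;> simp_all
  have e2 : (W.erase b).erase c = insert a B := by
    rw [hW]; ext x
    by_cases h1 : x = a <;> by_cases h2 : x = b <;> by_cases h3 : x = c <;> simp_all
  have e3 : (W.erase c).erase a = insert b B := by
    rw [hW]; ext x
    by_cases h1 : x = a <;> by_cases h2 : x = b <;> by_cases h3 : x = c <;> simp_all
  have hk := frobKos_triple v B a b c haB hbB hcB hab hbc hac
  rw [hv, coeff_zero] at hk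
  unfold frobG
  rw [e1, e2, e3]
  -- sign identities
  have s1 := frobSg_anti (K := K) (insert a B) b c (by simp [hbB, hab.symm])
    (by simp [hcB, hac.symm]) hbc
  have s2 := frobSg_anti (K := K) (insert b B) c a (by simp [hcB, hbc.symm])
    (by simp [haB, hab]) hac.symm
  have s3 := frobSg_anti (K := K) (insert c B) a b (by simp [haB, hac])
    (by simp [hbB, hbc]) hab
  have t1 := frobSg_anti (K := K) B a b haB hbB hab
  have t2 := frobSg_anti (K := K) B b c hbB hcB hbc
  have t3 := frobSg_anti (K := K) B c a hcB haB hac.symm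
  rw [Finset.insert_comm c a B] at *
  rw [Finset.insert_comm b a B] at *
  rw [Finset.insert_comm c b B] at *
  have qa := frobSg_sq (K := K) B a
  have qb := frobSg_sq (K := K) B b
  have qc := frobSg_sq (K := K) B c
  generalize coeff (Finsupp.single b 1 + Finsupp.single c 1) (v (insert a B)) = va at *
  generalize coeff (Finsupp.single c 1 + Finsupp.single a 1) (v (insert b B)) = vb at *
  generalize coeff (Finsupp.single a 1 + Finsupp.single b 1) (v (insert c B)) = vc at *
  generalize frobSg K B a = pa at *
  generalize frobSg K B b = pb at *
  generalize frobSg K B c = pc at *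
  generalize frobSg K (insert a B) b = pab at *
  generalize frobSg K (insert a B) c = pac at *
  generalize frobSg K (insert b B) a = pba at *
  generalize frobSg K (insert b B) c = pbc at *
  generalize frobSg K (insert c B) a = pca at *
  generalize frobSg K (insert c B) b = pcb at *
  generalize frobSg K (insert a (insert b B)) c = rc at *
  generalize frobSg K (insert a (insert c B)) b = rb at *
  generalize frobSg K (insert b (insert c B)) a = ra at *
  have h12 : pa * pab * rc = pb * pbc * ra := by linear_combination rc * t1 - pb * s2
  have h23 : pb * pbc * ra = pc * pca * rb := by linear_combination ra * t2 - pc * s3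
  linear_combination (-(pca * rb * vc)) * qc - (pab * rc * va) * qa - (pbc * ra * vb) * qb +
    pa * va * (h12 + h23) + pb * vb * h23 - (pc * pca * rb) * hk

lemma frob_dir2 (G : SimpleGraph (Fin n)) (h : HasLinearResolution (edgeIdeal K Gᶜ) 2) :
    IsChordal G := by
  classical
  rintro m hm ⟨f, hf⟩
  obtain ⟨l, rfl⟩ : ∃ l, m = l + 4 := ⟨m - 4, by omega⟩
  -- natural number parametrisation of the cycle
  let c : ℕ → Fin n := fun i => f (i : ZMod (l + 4))
  have hcinj : ∀ i j, i < l + 4 → j < l + 4 → c i = c j → i = j := by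
    intro i j hi hj hij
    have h1 : (i : ZMod (l + 4)) = j := f.injective hij
    have h2 := congrArg ZMod.val h1
    rwa [ZMod.val_natCast_of_lt hi, ZMod.val_natCast_of_lt hj] at h2
  have hadj : ∀ i, G.Adj (c i) (c (i + 1)) := by
    intro i
    rw [hf]
    refine ⟨fun h => ?_, Or.inr (by push_cast; ring)⟩
    have : (1 : ZMod (l + 4)) = 0 := by
      push_cast at h
      exact (left_eq_add.1 h)
    have h2 := congrArg ZMod.val this
    have h3 := ZMod.val_natCast_of_lt (n := l + 4) (a := 1) (by omega)
    rw [Nat.cast_one] at h3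
    rw [h3, ZMod.val_zero] at h2
    omega
  have hlast : G.Adj (c (l + 3)) (c 0) := by
    have := hadj (l + 3)
    have e : c (l + 3 + 1) = c 0 := by
      have e0 : ((l + 3 + 1 : ℕ) : ZMod (l + 4)) = ((0 : ℕ) : ZMod (l + 4)) :=
        (ZMod.natCast_self (l + 4)).trans Nat.cast_zero.symm
      exact congrArg f e0
    rwa [e] at this
  let W : Finset (Fin n) := (Finset.range (l + 4)).image c
  have hcW : ∀ i, i < l + 4 → c i ∈ W := fun i hi =>
    Finset.mem_image_of_mem c (Finset.mem_range.2 hi)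
  -- no vertex of W is adjacent to both c 0 and c 1
  have hno : ∀ x ∈ W, x ≠ c 0 → x ≠ c 1 → ¬ (G.Adj (c 0) x ∧ G.Adj (c 1) x) := by
    intro x hx hx0 hx1
    obtain ⟨i, hi, rfl⟩ := Finset.mem_image.1 hx
    rw [Finset.mem_range] at hi
    have hi0 : i ≠ 0 := fun h => hx0 (by rw [h])
    have hi1 : i ≠ 1 := fun h => hx1 (by rw [h])
    rintro ⟨h1, h2⟩
    rw [hf] at h1 h2
    have v0 : ((0 : ℕ) : ZMod (l + 2 + 2)).val = 0 := ZMod.val_natCast_of_lt (by omega)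
    have v1 : ((1 : ℕ) : ZMod (l + 2 + 2)).val = 1 := ZMod.val_natCast_of_lt (by omega)
    have vi : ((i : ℕ) : ZMod (l + 2 + 2)).val = i := ZMod.val_natCast_of_lt hi
    have h1' := h1.2
    have h2' := h2.2
    rw [frob_zmod_sub (l + 2), frob_zmod_sub (l + 2), v0, vi] at h1'
    rw [frob_zmod_sub (l + 2), frob_zmod_sub (l + 2), v1, vi] at h2'
    omega
  let E : Finset (Fin n) := (W.erase (c 0)).erase (c 1)
  let w : Finset (Fin n) → MvPolynomial (Fin n) K := fun B => if B = E then X (c 0) * X (c 1) else 0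
  have hw2 : ∀ B, (w B).IsHomogeneous 2 := by
    intro B
    simp only [w]
    split_ifs
    · exact (isHomogeneous_X K _).mul (isHomogeneous_X K _)
    · exact isHomogeneous_zero _ _ _
  have hwI : ∀ B, frobKos K w B ∈ edgeIdeal K Gᶜ := by
    intro B
    unfold frobKos
    refine Ideal.sum_mem _ fun a ha => ?_
    simp only [w]
    split_ifs with hB
    · have haE : a ∈ E := hB ▸ Finset.mem_insert_self a B
      simp only [E, Finset.mem_erase] at haE
      have h1 := hno a haE.2.2 haE.2.1 haE.1
      rw [smul_eq_mul]
      by_cases h2 : G.Adj (c 0) a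
      · have h3 : X (c 1) * X a ∈ edgeIdeal K Gᶜ := Ideal.subset_span
          ⟨c 1, a, ⟨Ne.symm haE.1, fun h3 => h1 ⟨h2, h3⟩⟩, rfl⟩
        have := Ideal.mul_mem_left _ (C (frobSg K B a) * X (c 0)) h3
        convert this using 1
        ring
      · have h3 : X (c 0) * X a ∈ edgeIdeal K Gᶜ := Ideal.subset_span
          ⟨c 0, a, ⟨Ne.symm haE.2.1, h2⟩, rfl⟩
        have := Ideal.mul_mem_left _ (C (frobSg K B a) * X (c 1)) h3
        convert this using 1
        ring
    · rw [smul_zero]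
      exact Ideal.zero_mem _
  obtain ⟨w', hw'I, hw'⟩ := frob_kos_bound h (frobKos K w) (frob_kos_hom w 2 hw2) hwI
    (frobKos_kos w)
  let v : Finset (Fin n) → MvPolynomial (Fin n) K := fun B => w B - w' B
  have hv : ∀ B, frobKos K v B = 0 := by
    intro B
    simp only [v]
    rw [frobKos_sub, hw', sub_self]
  have hcne : ∀ i j, i < l + 4 → j < l + 4 → i ≠ j → c i ≠ c j :=
    fun i j hi hj hij h => hij (hcinj i j hi hj h)
  -- edges other than c 0, c 1
  have hedge : ∀ i j, i < l + 4 → j < l + 4 → i ≠ j → 2 ≤ j → G.Adj (c i) (c j) →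
      frobG v W (c i) (c j) = 0 := by
    intro i j hi hj hij hj2 hA
    have hne : (W.erase (c i)).erase (c j) ≠ E := by
      intro he
      have h1 : c j ∈ E := by
        simp only [E, Finset.mem_erase]
        exact ⟨hcne _ _ hj (by omega) (by omega), hcne _ _ hj (by omega) (by omega), hcW j hj⟩
      rw [← he] at h1
      simp at h1
    unfold frobG
    simp only [v, w]
    rw [if_neg hne, coeff_sub, coeff_zero, frob_coeff_edge G _ (hw'I _) _ _ hA]
    simp
  have hind : ∀ k, k + 2 < l + 4 → frobG v W (c 1) (c (k + 2)) = 0 := by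
    intro k
    induction k with
    | zero =>
      intro hk
      exact hedge 1 2 (by omega) (by omega) (by omega) (by omega) (hadj 1)
    | succ k ih =>
      intro hk
      have h1 := ih (by omega)
      have h2 := hedge (k + 2) (k + 3) (by omega) (by omega) (by omega) (by omega) (hadj (k + 2))
      have h3 := frobG_triple v W hv (c 1) (c (k + 2)) (c (k + 3)) (hcW _ (by omega))
        (hcW _ (by omega)) (hcW _ (by omega)) (hcne _ _ (by omega) (by omega) (by omega))
        (hcne _ _ (by omega) (by omega) (by omega)) (hcne _ _ (by omega) (by omega) (by omega))
      have h4 := frobG_anti v W (c 1) (c (k + 3)) (hcne _ _ (by omega) (by omega) (by omega))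
      rw [h1, h2, h4] at h3
      have : c (k + 1 + 2) = c (k + 3) := rfl
      rw [this]
      simpa using h3
  have g1 := hind (l + 1) (by omega)
  have g2 := hedge 0 (l + 3) (by omega) (by omega) (by omega) (by omega) hlast.symm
  have g3 := frobG_triple v W hv (c 0) (c 1) (c (l + 3)) (hcW _ (by omega))
        (hcW _ (by omega)) (hcW _ (by omega)) (hcne _ _ (by omega) (by omega) (by omega))
        (hcne _ _ (by omega) (by omega) (by omega)) (hcne _ _ (by omega) (by omega) (by omega))
  have g4 := frobG_anti v W (c 0) (c (l + 3)) (hcne _ _ (by omega) (by omega) (by omega))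
  have g5 : c (l + 1 + 2) = c (l + 3) := rfl
  rw [g5] at g1
  rw [g4, g2, g1, neg_zero, add_zero, add_zero] at g3
  have hE : v E = X (c 0) * X (c 1) - w' E := by
    simp only [v, w]
    rw [if_pos trivial]
  unfold frobG at g3
  change frobSg K E (c 0) * frobSg K (insert (c 0) E) (c 1) * coeff _ (v E) = 0 at g3
  have hm1 : (X (c 0) * X (c 1) : MvPolynomial (Fin n) K) =
      monomial (Finsupp.single (c 0) 1 + Finsupp.single (c 1) 1) 1 := by
    simp [X, monomial_mul]
  have hc1 : coeff (Finsupp.single (c 0) 1 + Finsupp.single (c 1) 1) (v E) = 1 := by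
    rw [hE, coeff_sub, frob_coeff_edge G _ (hw'I _) _ _ (hadj 0), hm1, coeff_monomial, if_pos rfl,
      sub_zero]
  rw [hc1, mul_one] at g3
  have n1 : frobSg K E (c 0) ≠ 0 := left_ne_zero_of_mul_eq_one (frobSg_sq _ _)
  have n2 : frobSg K (insert (c 0) E) (c 1) ≠ 0 := left_ne_zero_of_mul_eq_one (frobSg_sq _ _)
  exact mul_ne_zero n1 n2 g3

end FrobDir2c

/-- Fröberg: if `G` is a non-complete chordal graph then `I(Ḡ)` has a
2-linear resolution over every field `K`; moreover, `G` is chordal iff `I(Ḡ)` has a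
linear resolution. -/
theorem stmt19 (K : Type) [Field K] (n : ℕ) (G : SimpleGraph (Fin n)) :
    ((IsChordal G ∧ ∃ i j : Fin n, i ≠ j ∧ ¬ G.Adj i j) →
      HasLinearResolution (edgeIdeal K Gᶜ) 2) ∧
    (IsChordal G ↔ HasLinearResolution (edgeIdeal K Gᶜ) 2) := by
  exact ⟨fun h => frob_dir1 n G h.1, frob_dir1 n G, frob_dir2 G⟩
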